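/- Suppose b satisfies Assumption 1 with ρ ∈ (1,2) and adopt the spectral setup. Then there exists C₁ > 0 such that for every s′ with 0 ≤ s′ ≤ 2, every t > 0 and every x ∈ H: Σ_k λ_k^{−s′} (s_k′(t))² (x,e_k)² ≤ C₁² ‖b‖_{L¹(0,t)}^{s′} t^{s′−2} ‖x‖²; equivalently, ‖A^{−s′/2} Ṡ(t)‖_{B(H)} ≤ C₁ ‖b‖_{L¹(0,t)}^{s′/2} t^{s′/2 − 1}. -/

import Mathlib

open MeasureTheory Filter Set
open scoped ENNReal NNReal RealInnerProductSpace

noncomputable section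

/-- The Laplace transform `b̂(z) = ∫₀^∞ e^{-zt} b(t) dt` of a real-valued kernel `b`. -/
def laplaceTransform (b : ℝ → ℝ) (z : ℂ) : ℂ :=
  ∫ t in Set.Ioi (0 : ℝ), Complex.exp (-z * t) * (b t : ℂ)

/-- Assumption 1: `b` is a nonzero, locally integrable, 3-monotone kernel
(with derivative `b'` on `(0,∞)`), `b(t) → 0` as `t → ∞`, and the angle condition
`ρ = 1 + (2/π) sup{|arg b̂(λ)| : Re λ > 0} ∈ (1,2)` holds. -/
structure Assumption1 (b b' : ℝ → ℝ) (ρ : ℝ) : Prop where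
  locInt : ∀ T > 0, IntegrableOn b (Set.Ioc 0 T)
  ne_zero : ∃ t > 0, b t ≠ 0
  nonneg : ∀ t > 0, 0 ≤ b t
  anti : AntitoneOn b (Set.Ioi 0)
  cvx : ConvexOn ℝ (Set.Ioi 0) b
  hasDeriv : ∀ t > 0, HasDerivAt b (b' t) t
  deriv_nonpos : ∀ t > 0, b' t ≤ 0
  deriv_anti : AntitoneOn (fun t => -(b' t)) (Set.Ioi 0)
  deriv_cvx : ConvexOn ℝ (Set.Ioi 0) (fun t => -(b' t))
  tendsto_zero : Tendsto b atTop (nhds 0)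
  rho_eq : ρ = 1 + (2 / Real.pi) *
      sSup {θ : ℝ | ∃ z : ℂ, 0 < z.re ∧ θ = |(laplaceTransform b z).arg|}
  rho_mem : ρ ∈ Set.Ioo (1 : ℝ) 2

/-- Assumption 2: `b̂` extends analytically to a sector `Σ_θ`, `θ > π/2`, with the
bounds `|b̂^{(k)}(z)| ≤ C |z|^{1-ρ-k}`, `k = 0,1`, there. -/
structure Assumption2 (b : ℝ → ℝ) (ρ θ : ℝ) : Prop where
  theta_gt : Real.pi / 2 < θ
  holo : ∃ B : ℂ → ℂ,
    (∀ z : ℂ, z ≠ 0 → |z.arg| < θ → DifferentiableAt ℂ B z) ∧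
    (∀ z : ℂ, 0 < z.re → B z = laplaceTransform b z) ∧
    ∃ C > 0, (∀ z : ℂ, z ≠ 0 → |z.arg| < θ → ‖B z‖ ≤ C * ‖z‖ ^ (1 - ρ)) ∧
      (∀ z : ℂ, z ≠ 0 → |z.arg| < θ → ‖deriv B z‖ ≤ C * ‖z‖ ^ (-ρ))

/-- `s` (with derivative `s'` on `(0,∞)`) solves the scalar Volterra equation
`s'(t) + λ ∫₀ᵗ b(t-u) s(u) du = 0`, `s(0) = 1`. -/
structure IsScalarSolution (b : ℝ → ℝ) (lam : ℝ) (s s' : ℝ → ℝ) : Prop where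
  init : s 0 = 1
  cont : ContinuousOn s (Set.Ici 0)
  hasDeriv : ∀ t > 0, HasDerivAt s (s' t) t
  eqn : ∀ t > 0, s' t + lam * ∫ u in (0 : ℝ)..t, b (t - u) * s u = 0

/-- The resolvent family `S(t)x = Σ_k s_k(t) (x,e_k) e_k`. -/
def Sop {H : Type*} [NormedAddCommGroup H] [InnerProductSpace ℝ H]
    (e : HilbertBasis ℕ ℝ H) (s : ℕ → ℝ → ℝ) (t : ℝ) (x : H) : H :=
  ∑' k, (s k t * ⟪x, e k⟫) • (e k : H)

/-- The Backward Euler convolution quadrature operator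
`B_k = ∫₀^∞ F(Δt s) e^{-s} s^{k-1}/(k-1)! ds`. -/
def quadB {H : Type*} [NormedAddCommGroup H] [NormedSpace ℝ H]
    (Δt : ℝ) (F : ℝ → H) (k : ℕ) : H :=
  ∫ u in Set.Ioi (0 : ℝ),
    (Real.exp (-u) * u ^ (k - 1) / (Nat.factorial (k - 1) : ℝ)) • F (Δt * u)

/-- The finite element setup: `f` is an orthonormal basis of the finite dimensional
subspace `V_h ⊆ D(A^{1/2})`, consisting of eigenvectors of the discrete operator `A_h`
(defined via the bilinear form `a(u,v) = Σ_k λ_k (u,e_k)(v,e_k)`) with positive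
eigenvalues `μ`. -/
structure FESetup {H : Type*} [NormedAddCommGroup H] [InnerProductSpace ℝ H]
    (e : HilbertBasis ℕ ℝ H) (lam : ℕ → ℝ) (N : ℕ) (f : Fin N → H) (μ : Fin N → ℝ) :
    Prop where
  f_orth : Orthonormal ℝ f
  mu_pos : ∀ j, 0 < μ j
  f_dom : ∀ j, (∑' k, ENNReal.ofReal (lam k * ⟪f j, e k⟫ ^ 2)) < ⊤
  eigen : ∀ j j', (∑' k, lam k * ⟪f j, e k⟫ * ⟪f j', e k⟫) = μ j * ⟪f j, f j'⟫

/-- A 3-monotone kernel is a superposition of triangle kernels `t ↦ (a - t)₊`. -/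
theorem Assumption1.exists_triangle_measure {b b' : ℝ → ℝ} {ρ : ℝ} (hb : Assumption1 b b' ρ) :
    ∃ ν : Measure ℝ, SFinite ν ∧ (∀ᵐ a ∂ν, 0 < a) ∧
      ∀ t > 0, ∫⁻ a, ENNReal.ofReal (a - t) ∂ν = ENNReal.ofReal (b t) := by
  set g : ℝ → ℝ := fun t => -(b' t) with hg
  have g_nonneg : ∀ t > 0, 0 ≤ g t := fun t ht => neg_nonneg.2 (hb.deriv_nonpos t ht)
  have g_int : ∀ t > 0, IntegrableOn g (Ioi t) := fun t ht =>
    (integrableOn_Ioi_deriv_of_nonpos' (fun x hx => hb.hasDeriv x (lt_of_lt_of_le ht hx))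
      (fun x hx => hb.deriv_nonpos x (lt_trans ht hx)) hb.tendsto_zero).neg
  have g_eq : ∀ t > 0, ∫ u in Ioi t, g u = b t := fun t ht => by
    rw [hg, integral_neg, integral_Ioi_of_hasDerivAt_of_nonpos'
      (fun x hx => hb.hasDeriv x (lt_of_lt_of_le ht hx))
      (fun x hx => hb.deriv_nonpos x (lt_trans ht hx)) hb.tendsto_zero]
    ring
  set S : ℝ → Set ℝ := fun y => {u | 0 < u ∧ y < g u} with hS
  have S_bdd : ∀ y > 0, BddAbove (S y) := by
    intro y hy
    refine ⟨1 + b 1 / y, ?_⟩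
    rintro u ⟨hu, hyu⟩
    by_contra! hlt
    have hb1 : 0 ≤ b 1 := hb.nonneg 1 one_pos
    have h1 : 1 < u := by have := div_nonneg hb1 hy.le; linarith
    have h2 : ∫ x in Ioc 1 u, y ≤ ∫ x in Ioc 1 u, g x := by
      refine setIntegral_mono_on (by simp) ((g_int 1 one_pos).mono_set Ioc_subset_Ioi_self)
        measurableSet_Ioc fun x hx => ?_
      exact hyu.le.trans (hb.deriv_anti (show (0 : ℝ) < x by linarith [hx.1]) hu hx.2)
    have h3 : ∫ x in Ioc 1 u, g x ≤ ∫ x in Ioi 1, g x :=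
      setIntegral_mono_set (g_int 1 one_pos)
        ((ae_restrict_iff' measurableSet_Ioi).2 (Eventually.of_forall fun x hx =>
          g_nonneg x (lt_trans one_pos hx)))
        (LE.le.eventuallyLE Ioc_subset_Ioi_self)
    rw [g_eq 1 one_pos] at h3
    have h4 : (u - 1) * y ≤ b 1 := by
      simpa [h1.le] using h2.trans h3
    have h5 : b 1 / y < u - 1 := by linarith
    rw [div_lt_iff₀ hy] at h5
    linarith
  set A : ℝ → ℝ := fun y => sSup (S y) with hA
  have A_anti : AntitoneOn A (Ioi 0) := by
    intro x hx y hy hxy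
    rcases (S y).eq_empty_or_nonempty with h | h
    · simp only [hA, h, Real.sSup_empty]
      exact Real.sSup_nonneg fun u hu => hu.1.le
    · exact csSup_le_csSup (S_bdd x hx) h fun u hu => ⟨hu.1, lt_of_le_of_lt hxy hu.2⟩
  have A_meas : AEMeasurable A (volume.restrict (Ioi 0)) :=
    aemeasurable_restrict_of_antitoneOn measurableSet_Ioi A_anti
  have key : ∀ t > 0, ∀ y > 0,
      (volume.restrict (Ioi t)) {u | y < g u} = ENNReal.ofReal (A y - t) := by
    intro t ht y hy
    have hlt : ∀ u, 0 < u → u < A y → y < g u := by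
      intro u hu hua
      have hne : (S y).Nonempty := by
        by_contra h
        rw [not_nonempty_iff_eq_empty] at h
        simp only [hA, h, Real.sSup_empty] at hua
        linarith
      obtain ⟨v, hv, huv⟩ := exists_lt_of_lt_csSup hne hua
      exact lt_of_lt_of_le hv.2 (hb.deriv_anti hu hv.1 huv.le)
    rw [Measure.restrict_apply₀']
    · apply le_antisymm
      · calc volume ({u | y < g u} ∩ Ioi t) ≤ volume (Ioc t (A y)) := by
              apply measure_mono
              rintro u ⟨h1, h2⟩
              exact ⟨h2, le_csSup (S_bdd y hy) ⟨lt_trans ht h2, h1⟩⟩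
          _ = _ := by simp
      · calc ENNReal.ofReal (A y - t) = volume (Ioo t (A y)) := by simp
          _ ≤ _ := by
              apply measure_mono
              rintro u ⟨h1, h2⟩
              exact ⟨hlt u (lt_trans ht h1) h2, h1⟩
    · exact measurableSet_Ioi.nullMeasurableSet
  have rep : ∀ t > 0, ∫⁻ y in Ioi 0, ENNReal.ofReal (A y - t) = ENNReal.ofReal (b t) := by
    intro t ht
    have hnn : 0 ≤ᵐ[volume.restrict (Ioi t)] g :=
      (ae_restrict_iff' measurableSet_Ioi).2 (Eventually.of_forall fun x hx =>
          g_nonneg x (lt_trans ht hx))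
    rw [← g_eq t ht, ofReal_integral_eq_lintegral_ofReal (g_int t ht) hnn,
      lintegral_eq_lintegral_meas_lt _ hnn (g_int t ht).aemeasurable]
    exact setLIntegral_congr_fun measurableSet_Ioi fun y hy => (key t ht y hy).symm
  refine ⟨((volume.restrict (Ioi 0)).map A).restrict (Ioi 0), inferInstance,
    ae_restrict_mem measurableSet_Ioi, fun t ht => ?_⟩
  rw [← rep t ht, setLIntegral_eq_of_support_subset, lintegral_map' (by fun_prop) A_meas]
  intro a ha
  have : ENNReal.ofReal (a - t) ≠ 0 := ha
  have h2 : 0 < a - t := by simpa using this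
  exact show (0 : ℝ) < a by linarith

/-- Integration against a superposition of triangle kernels, by Fubini. -/
theorem integral_smul_of_triangle {b : ℝ → ℝ} {ν : Measure ℝ} [SFinite ν]
    (hν : ∀ t > 0, ∫⁻ a, ENNReal.ofReal (a - t) ∂ν = ENNReal.ofReal (b t))
    (hb : ∀ t > 0, 0 ≤ b t) {E : Type*} [NormedAddCommGroup E] [NormedSpace ℝ E] [CompleteSpace E]
    {F : ℝ → E} (hF : AEStronglyMeasurable F (volume.restrict (Ioi 0)))
    (hFb : IntegrableOn (fun t => b t • F t) (Ioi 0)) :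
    Integrable (fun a => ∫ t in Ioi 0, max (a - t) 0 • F t) ν ∧
      ∫ t in Ioi 0, b t • F t = ∫ a, (∫ t in Ioi 0, max (a - t) 0 • F t) ∂ν := by
  have hK : ∀ t > 0, Integrable (fun a => max (a - t) 0) ν ∧ ∫ a, max (a - t) 0 ∂ν = b t := by
    intro t ht
    have h0 : ∫⁻ a, ENNReal.ofReal (max (a - t) 0) ∂ν = ENNReal.ofReal (b t) := by
      rw [← hν t ht]
      congr with a
      simp [ENNReal.ofReal_max]
    have hnn : 0 ≤ᵐ[ν] fun a => max (a - t) 0 := Eventually.of_forall fun a => le_max_right _ _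
    constructor
    · refine (lintegral_ofReal_ne_top_iff_integrable (by fun_prop) hnn).1 ?_
      rw [h0]; exact ENNReal.ofReal_ne_top
    · rw [integral_eq_lintegral_of_nonneg_ae hnn (by fun_prop), h0,
        ENNReal.toReal_ofReal (hb t ht)]
  have hint : Integrable (Function.uncurry fun t a => max (a - t) 0 • F t)
      ((volume.restrict (Ioi 0)).prod ν) := by
    have hm : AEStronglyMeasurable (Function.uncurry fun t a => max (a - t) 0 • F t)
        ((volume.restrict (Ioi 0)).prod ν) := by
      refine AEStronglyMeasurable.smul (f := fun p : ℝ × ℝ => max (p.2 - p.1) 0)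
        (g := fun p : ℝ × ℝ => F p.1) ?_ hF.comp_fst
      exact Measurable.aestronglyMeasurable (by fun_prop)
    rw [integrable_prod_iff hm]
    constructor
    · filter_upwards [ae_restrict_mem measurableSet_Ioi] with t ht
      exact (hK t ht).1.smul_const (F t)
    · refine hFb.norm.congr ?_
      filter_upwards [ae_restrict_mem measurableSet_Ioi] with t ht
      have : ∀ a, ‖max (a - t) 0 • F t‖ = max (a - t) 0 * ‖F t‖ := fun a => by
        rw [norm_smul, Real.norm_of_nonneg (le_max_right _ _)]
      simp only [Function.uncurry_apply_pair, this]
      rw [integral_mul_const, (hK t ht).2, norm_smul, Real.norm_of_nonneg (hb t ht)]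
  refine ⟨hint.integral_prod_right, ?_⟩
  rw [← integral_integral_swap hint]
  refine setIntegral_congr_fun measurableSet_Ioi fun t ht => ?_
  rw [integral_smul_const, (hK t ht).2]

/-- Integration against a triangle kernel reduces to its support. -/
theorem setIntegral_triangle_smul {E : Type*} [NormedAddCommGroup E] [NormedSpace ℝ E]
    {a : ℝ} (ha : 0 < a) (F : ℝ → E) :
    ∫ t in Ioi 0, max (a - t) 0 • F t = ∫ t in (0 : ℝ)..a, (a - t) • F t := by
  rw [intervalIntegral.integral_of_le ha.le,
    setIntegral_eq_of_subset_of_forall_sdiff_eq_zero (s := Ioc 0 a) measurableSet_Ioi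
      Ioc_subset_Ioi_self]
  · refine setIntegral_congr_fun measurableSet_Ioc fun t ht => ?_
    rw [max_eq_left (by linarith [ht.2])]
  · intro t ht
    have : a < t := by
      by_contra! h
      exact ht.2 ⟨ht.1, h⟩
    rw [max_eq_right (by linarith), zero_smul]

theorem integral_triangle_exp {a : ℝ} {z : ℂ} (hz : z ≠ 0) :
    ∫ t in (0 : ℝ)..a, (a - t) • Complex.exp (-z * t) =
      (Complex.exp (-(z * a)) - 1 + z * a) / z ^ 2 := by
  have hd : ∀ t : ℝ, HasDerivAt (fun t : ℝ =>
      (Complex.exp (-z * t) - z * (a - t) * Complex.exp (-z * t)) / z ^ 2)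
      ((a - t) • Complex.exp (-z * t)) t := by
    intro t
    have h1 : HasDerivAt (fun t : ℝ => (t : ℂ)) 1 t := Complex.ofRealCLM.hasDerivAt
    have h2 : HasDerivAt (fun t : ℝ => Complex.exp (-z * t)) (Complex.exp (-z * t) * (-z * 1)) t :=
      (h1.const_mul (-z)).cexp
    have h3 := (h2.sub (((h1.const_sub (a : ℂ)).const_mul z).mul h2)).div_const (z ^ 2)
    refine h3.congr_deriv ?_
    rw [Complex.real_smul]
    push_cast
    field_simp
    ring
  rw [intervalIntegral.integral_eq_sub_of_hasDerivAt (fun t _ => hd t)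
    (Continuous.intervalIntegrable (by fun_prop) _ _)]
  simp
  field_simp
  ring

theorem integral_triangle_exp_add {a : ℝ} {z : ℂ} (hz : z ≠ 0) :
    ∫ t in (0 : ℝ)..a, (a - t) • ((1 + z * t) * Complex.exp (-z * t)) =
      (3 * (Complex.exp (-(z * a)) - 1 + z * a) + z * a * (Complex.exp (-(z * a)) - 1)) / z ^ 2 := by
  have hd : ∀ t : ℝ, HasDerivAt (fun t : ℝ =>
      (3 - z * (a - t) * 2 + z * t - (z * (a - t)) * (z * t)) * Complex.exp (-z * t) / z ^ 2)
      ((a - t) • ((1 + z * t) * Complex.exp (-z * t))) t := by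
    intro t
    have h1 : HasDerivAt (fun t : ℝ => (t : ℂ)) 1 t := Complex.ofRealCLM.hasDerivAt
    have h2 : HasDerivAt (fun t : ℝ => Complex.exp (-z * t)) (Complex.exp (-z * t) * (-z * 1)) t :=
      (h1.const_mul (-z)).cexp
    have h4 := (h1.const_sub (a : ℂ)).const_mul z
    have h3 := ((((((h4.mul_const 2).const_sub 3).add (h1.const_mul z)).sub
      (h4.mul (h1.const_mul z)))).mul h2).div_const (z ^ 2)
    refine h3.congr_deriv ?_
    rw [Complex.real_smul]
    simp
    field_simp
    ring
  rw [intervalIntegral.integral_eq_sub_of_hasDerivAt (fun t _ => hd t)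
    (Continuous.intervalIntegrable (by fun_prop) _ _)]
  simp
  field_simp
  ring

theorem norm_exp_neg_sub_one_le {x : ℂ} (hx : 0 ≤ x.re) : ‖Complex.exp (-x) - 1‖ ≤ ‖x‖ := by
  have h := (convex_halfSpace_re_ge 0).norm_image_sub_le_of_norm_hasDerivWithin_le
    (f := fun w => Complex.exp (-w)) (f' := fun w => -Complex.exp (-w)) (C := 1) (x := 0) (y := x)
    (fun w _ => by
      have := ((hasDerivAt_id w).neg).cexp
      exact (this.congr_deriv (by simp)).hasDerivWithinAt)
    (fun w hw => by
      have : (0 : ℝ) ≤ w.re := hw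
      rw [norm_neg, Complex.norm_exp]; simpa using this) (by simp) hx
  simpa using h

theorem norm_exp_neg_sub_one_le_of_one_le {x : ℂ} (hx : 0 ≤ x.re) (h1 : 1 ≤ ‖x‖) :
    ‖Complex.exp (-x) - 1‖ ≤ 0.993 * ‖x‖ := by
  have hexp : ∀ w : ℂ, 0 ≤ w.re → ‖Complex.exp (-w)‖ ≤ 1 := fun w hw => by
    rw [Complex.norm_exp]; simpa using hw
  rcases le_or_gt 3 ‖x‖ with h3 | h3
  · have := norm_sub_le (Complex.exp (-x)) 1
    have h4 := hexp x hx
    simp only [norm_one] at this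
    linarith
  obtain ⟨w, rfl⟩ : ∃ w, x = 2 * w := ⟨x / 2, by ring⟩
  have hw : 0 ≤ w.re := by simpa using hx
  have hn : ‖2 * w‖ = 2 * ‖w‖ := by simp
  rw [hn] at h1 h3 ⊢
  have hfac : Complex.exp (-(2 * w)) - 1 = (Complex.exp (-w) - 1) * (1 + Complex.exp (-w)) := by
    rw [show -(2 * w) = -w + -w by ring, Complex.exp_add]; ring
  suffices h : ‖1 + Complex.exp (-w)‖ ≤ 1.986 by
    rw [hfac, norm_mul]
    calc _ ≤ ‖w‖ * 1.986 := by gcongr; exact norm_exp_neg_sub_one_le hw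
      _ = _ := by ring
  have hexpw : Complex.exp (-w) =
      ⟨Real.exp (-w.re) * Real.cos w.im, -(Real.exp (-w.re) * Real.sin w.im)⟩ := by
    apply Complex.ext <;> simp [Complex.exp_re, Complex.exp_im]
  have hsq : ‖1 + Complex.exp (-w)‖ ^ 2 =
      1 + 2 * (Real.exp (-w.re) * Real.cos w.im) + Real.exp (-w.re) ^ 2 := by
    rw [hexpw, ← Complex.normSq_eq_norm_sq, Complex.normSq_apply]
    simp
    linear_combination Real.exp (-w.re) ^ 2 * Real.sin_sq_add_cos_sq w.im
  have hE : Real.exp (-w.re) ≤ 1 := by simpa using hw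
  have hE0 := Real.exp_pos (-w.re)
  refine abs_le_of_sq_le_sq' ?_ (by norm_num) |>.2
  rw [hsq]
  rcases le_or_gt 0.3 w.re with hr | hr
  · have h5 : Real.exp (-w.re) ≤ 10 / 13 := by
      rw [Real.exp_neg, inv_le_comm₀ (Real.exp_pos _) (by norm_num)]
      have := Real.add_one_le_exp w.re
      norm_num at *
      linarith
    have h6 : Real.exp (-w.re) * Real.cos w.im ≤ Real.exp (-w.re) * 1 := by
      gcongr; exact Real.cos_le_one _
    nlinarith
  · have hw2 : ‖w‖ ^ 2 = w.re ^ 2 + w.im ^ 2 := by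
      rw [← Complex.normSq_eq_norm_sq, Complex.normSq_apply]; ring
    have him : 0.16 ≤ w.im ^ 2 := by nlinarith
    have him2 : |w.im| ≤ Real.pi := by
      have := Complex.abs_im_le_norm w
      linarith [Real.pi_gt_three]
    have hpi : Real.pi ^ 2 ≤ 10 := by
      have := Real.pi_lt_d2
      have := Real.pi_pos
      nlinarith
    have hc : Real.cos w.im ≤ 0.968 := by
      have h7 := Real.cos_le_one_sub_mul_cos_sq him2
      have h8 : 0.2 ≤ 2 / Real.pi ^ 2 := by
        rw [le_div_iff₀ (by positivity)]; linarith
      nlinarith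
    have h6 : Real.exp (-w.re) * Real.cos w.im ≤ 0.968 := by
      nlinarith
    nlinarith

theorem integrableOn_mul_exp_neg {f : ℝ → ℝ} {C η : ℝ}
    (hm : AEStronglyMeasurable f (volume.restrict (Ioi 0))) (h0 : IntegrableOn f (Ioc 0 1))
    (hC : ∀ t > 1, |f t| ≤ C) (hη : 0 < η) :
    IntegrableOn (fun t => f t * Real.exp (-η * t)) (Ioi 0) := by
  have hsplit : Ioi (0 : ℝ) = Ioc 0 1 ∪ Ioi 1 := (Ioc_union_Ioi_eq_Ioi zero_le_one).symm
  rw [hsplit]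
  refine IntegrableOn.union ?_ ?_
  · refine Integrable.mul_bdd (c := 1) h0 (by fun_prop) ?_
    filter_upwards [ae_restrict_mem measurableSet_Ioc] with t ht
    rw [Real.norm_of_nonneg (Real.exp_pos _).le]
    exact Real.exp_le_one_iff.2 (by nlinarith [ht.1])
  · refine Integrable.bdd_mul (c := C) (integrableOn_exp_mul_Ioi (by linarith) 1)
      (hm.mono_set (Ioi_subset_Ioi zero_le_one)) ?_
    filter_upwards [ae_restrict_mem measurableSet_Ioi] with t ht
    exact hC t ht

/-- Integrability of `f · G` on the half-line for an exponentially decaying weight `G`. -/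
theorem integrableOn_smul_of_exp_decay {f : ℝ → ℝ} {C η K : ℝ} {G : ℝ → ℂ}
    (hm : AEStronglyMeasurable f (volume.restrict (Ioi 0))) (h0 : IntegrableOn f (Ioc 0 1))
    (hC : ∀ t > 1, |f t| ≤ C) (hη : 0 < η) (hG : Continuous G)
    (hGK : ∀ t > 0, ‖G t‖ ≤ K * Real.exp (-η * t)) :
    IntegrableOn (fun t => f t • G t) (Ioi 0) := by
  refine Integrable.mono ((integrableOn_mul_exp_neg hm h0 hC hη).const_mul K)
    (hm.smul hG.aestronglyMeasurable) ?_
  filter_upwards [ae_restrict_mem measurableSet_Ioi] with t ht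
  rw [norm_smul, norm_mul, norm_mul, Real.norm_of_nonneg (Real.exp_pos _).le]
  calc ‖f t‖ * ‖G t‖ ≤ ‖f t‖ * (K * Real.exp (-η * t)) := by gcongr; exact hGK t ht
    _ ≤ ‖f t‖ * (‖K‖ * Real.exp (-η * t)) := by gcongr; exact Real.le_norm_self K
    _ = _ := by ring

theorem norm_exp_neg_mul_ofReal (z : ℂ) (t : ℝ) :
    ‖Complex.exp (-z * t)‖ = Real.exp (-z.re * t) := by
  rw [Complex.norm_exp]; simp

theorem norm_mul_exp_neg_mul_ofReal_le {z : ℂ} (hz : 0 < z.re) {t : ℝ} (ht : 0 < t) :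
    ‖t * Complex.exp (-z * t)‖ ≤ 2 / z.re * Real.exp (-(z.re / 2) * t) := by
  rw [norm_mul, norm_exp_neg_mul_ofReal, Complex.norm_real, Real.norm_of_nonneg ht.le]
  have h1 : t ≤ 2 / z.re * Real.exp (z.re / 2 * t) := by
    have := Real.add_one_le_exp (z.re / 2 * t)
    calc t = 2 / z.re * (z.re / 2 * t) := by field_simp
      _ ≤ _ := by gcongr; linarith
  calc t * Real.exp (-z.re * t) ≤ 2 / z.re * Real.exp (z.re / 2 * t) * Real.exp (-z.re * t) := by
        gcongr
    _ = _ := by rw [mul_assoc, ← Real.exp_add]; congr 2; ring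

theorem integrableOn_smul_exp {f : ℝ → ℝ} {C : ℝ} {z : ℂ}
    (hm : AEStronglyMeasurable f (volume.restrict (Ioi 0))) (h0 : IntegrableOn f (Ioc 0 1))
    (hC : ∀ t > 1, |f t| ≤ C) (hz : 0 < z.re) :
    IntegrableOn (fun t => f t • Complex.exp (-z * t)) (Ioi 0) :=
  integrableOn_smul_of_exp_decay (K := 1) hm h0 hC hz (by fun_prop) fun t _ => by
    rw [norm_exp_neg_mul_ofReal, one_mul]

theorem integrableOn_smul_mul_exp {f : ℝ → ℝ} {C : ℝ} {z : ℂ}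
    (hm : AEStronglyMeasurable f (volume.restrict (Ioi 0))) (h0 : IntegrableOn f (Ioc 0 1))
    (hC : ∀ t > 1, |f t| ≤ C) (hz : 0 < z.re) :
    IntegrableOn (fun t => f t • (t * Complex.exp (-z * t))) (Ioi 0) :=
  integrableOn_smul_of_exp_decay hm h0 hC (half_pos hz) (by fun_prop) fun _ ht =>
    norm_mul_exp_neg_mul_ofReal_le hz ht

namespace Assumption1

variable {b b' : ℝ → ℝ} {ρ : ℝ}

theorem continuousOn (hb : Assumption1 b b' ρ) : ContinuousOn b (Ioi 0) := fun t ht =>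
  (hb.hasDeriv t ht).continuousAt.continuousWithinAt

theorem aestronglyMeasurable (hb : Assumption1 b b' ρ) :
    AEStronglyMeasurable b (volume.restrict (Ioi 0)) :=
  hb.continuousOn.aestronglyMeasurable measurableSet_Ioi

theorem abs_le_apply_one (hb : Assumption1 b b' ρ) : ∀ t > 1, |b t| ≤ b 1 := fun t ht => by
  rw [abs_of_nonneg (hb.nonneg t (by linarith))]
  exact hb.anti (show (0 : ℝ) < 1 by norm_num) (show (0 : ℝ) < t by linarith) ht.le

theorem integrableOn_exp (hb : Assumption1 b b' ρ) {z : ℂ} (hz : 0 < z.re) :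
    IntegrableOn (fun t => b t • Complex.exp (-z * t)) (Ioi 0) :=
  integrableOn_smul_exp hb.aestronglyMeasurable (hb.locInt 1 one_pos) hb.abs_le_apply_one hz

theorem integrableOn_mul_exp (hb : Assumption1 b b' ρ) {z : ℂ} (hz : 0 < z.re) :
    IntegrableOn (fun t => b t • (t * Complex.exp (-z * t))) (Ioi 0) :=
  integrableOn_smul_mul_exp hb.aestronglyMeasurable (hb.locInt 1 one_pos) hb.abs_le_apply_one hz

theorem laplaceTransform_eq (z : ℂ) :
    laplaceTransform b z = ∫ t in Ioi 0, b t • Complex.exp (-z * t) := by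
  simp only [laplaceTransform, Complex.real_smul, mul_comm]

/-- The primitive of `b` is a superposition of the primitives of triangle kernels. -/
theorem primitive_repr (hb : Assumption1 b b' ρ) {ν : Measure ℝ} [SFinite ν]
    (hpos : ∀ᵐ a ∂ν, 0 < a)
    (hν : ∀ t > 0, ∫⁻ a, ENNReal.ofReal (a - t) ∂ν = ENNReal.ofReal (b t)) {τ : ℝ} (hτ : 0 < τ) :
    Integrable (fun a => a * min a τ - min a τ ^ 2 / 2) ν ∧
      ∫ u in (0 : ℝ)..τ, b u = ∫ a, (a * min a τ - min a τ ^ 2 / 2) ∂ν := by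
  have h1 : (fun t => b t • (Ioc 0 τ).indicator (fun _ => (1 : ℝ)) t) = (Ioc 0 τ).indicator b := by
    ext t
    by_cases ht : t ∈ Ioc 0 τ <;> simp [ht]
  have hF : IntegrableOn (fun t => b t • (Ioc 0 τ).indicator (fun _ => (1 : ℝ)) t) (Ioi 0) := by
    rw [h1]
    exact ((integrable_indicator_iff measurableSet_Ioc).2 (hb.locInt τ hτ)).integrableOn
  have := integral_smul_of_triangle hν hb.nonneg
    (F := (Ioc 0 τ).indicator (fun _ => (1 : ℝ)))
    (aestronglyMeasurable_const.indicator measurableSet_Ioc) hF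
  have hker : ∀ᵐ a ∂ν, ∫ t in Ioi 0, max (a - t) 0 • (Ioc 0 τ).indicator (fun _ => (1 : ℝ)) t =
      a * min a τ - min a τ ^ 2 / 2 := by
    filter_upwards [hpos] with a ha
    rw [setIntegral_triangle_smul ha, intervalIntegral.integral_of_le ha.le]
    have h2 : (fun t => (a - t) • (Ioc 0 τ).indicator (fun _ => (1 : ℝ)) t) =
        (Ioc 0 τ).indicator fun t => a - t := by
      ext t
      by_cases ht : t ∈ Ioc 0 τ <;> simp [ht]
    rw [h2, setIntegral_indicator measurableSet_Ioc, Ioc_inter_Ioc, max_self,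
      ← intervalIntegral.integral_of_le (le_min ha.le hτ.le)]
    rw [intervalIntegral.integral_sub (by simp) (by simp)]
    simp
    ring
  refine ⟨this.1.congr hker, ?_⟩
  rw [← integral_congr_ae hker, ← this.2, h1, setIntegral_indicator measurableSet_Ioc,
    inter_eq_right.2 Ioc_subset_Ioi_self, intervalIntegral.integral_of_le hτ.le]

theorem mul_min_le {a τ : ℝ} (ha : 0 < a) (hτ : 0 < τ) :
    a * min a τ / 2 ≤ a * min a τ - min a τ ^ 2 / 2 ∧
      a * min a τ - min a τ ^ 2 / 2 ≤ a * min a τ := by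
  have h1 := min_le_left a τ
  have h2 : 0 < min a τ := lt_min ha hτ
  constructor <;> nlinarith

/-- `|b̂(z) - z b̂'(z)|` is controlled by the primitive of `b` at `1 / |z|`. -/
theorem norm_laplace_add_le (hb : Assumption1 b b' ρ) {z : ℂ} (hz : 0 < z.re) :
    ‖laplaceTransform b z + z * ∫ t in Ioi 0, b t • (t * Complex.exp (-z * t))‖ ≤
      16 * ∫ u in (0 : ℝ)..‖z‖⁻¹, b u := by
  obtain ⟨ν, _, hpos, hν⟩ := hb.exists_triangle_measure
  have hz0 : z ≠ 0 := by rintro rfl; simp at hz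
  have hzn : 0 < ‖z‖ := norm_pos_iff.2 hz0
  have hsum : (fun t => b t • ((1 + z * t) * Complex.exp (-z * t))) =
      fun t => b t • Complex.exp (-z * t) + z * (b t • (t * Complex.exp (-z * t))) := by
    ext t
    simp only [Complex.real_smul]
    ring
  have h1 : laplaceTransform b z + z * ∫ t in Ioi 0, b t • (t * Complex.exp (-z * t)) =
      ∫ t in Ioi 0, b t • ((1 + z * t) * Complex.exp (-z * t)) := by
    rw [hsum, integral_add (hb.integrableOn_exp hz) ((hb.integrableOn_mul_exp hz).const_mul z),
      integral_const_mul, laplaceTransform_eq]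
  have hF : IntegrableOn (fun t => b t • ((1 + z * t) * Complex.exp (-z * t))) (Ioi 0) := by
    rw [hsum]
    exact (hb.integrableOn_exp hz).add ((hb.integrableOn_mul_exp hz).const_mul z)
  have h2 := integral_smul_of_triangle hν hb.nonneg
    (F := fun t : ℝ => (1 + z * t) * Complex.exp (-z * t)) (by fun_prop) hF
  have h3 := hb.primitive_repr hpos hν (inv_pos.2 hzn)
  rw [h1, h2.2, h3.2, ← integral_const_mul]
  refine norm_integral_le_of_norm_le (h3.1.const_mul 16) ?_
  filter_upwards [hpos] with a ha
  rw [setIntegral_triangle_smul ha, integral_triangle_exp_add hz0, norm_div, norm_pow,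
    div_le_iff₀ (by positivity)]
  have hx : 0 ≤ (z * a).re := by simp; positivity
  have hxn : ‖z * a‖ = ‖z‖ * a := by simp [abs_of_pos ha]
  have h4 := norm_exp_neg_sub_one_le hx
  have h5 := (mul_min_le ha (inv_pos.2 hzn)).1
  have h6 : ‖3 * (Complex.exp (-(z * a)) - 1 + z * a) + z * a * (Complex.exp (-(z * a)) - 1)‖ ≤
      3 * ‖Complex.exp (-(z * a)) - 1 + z * a‖ + ‖z * a‖ * ‖Complex.exp (-(z * a)) - 1‖ := by
    refine (norm_add_le _ _).trans (le_of_eq ?_)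
    rw [norm_mul, norm_mul (z * a)]
    norm_num
  have h7 : ‖3 * (Complex.exp (-(z * a)) - 1 + z * a) +
      z * a * (Complex.exp (-(z * a)) - 1)‖ ≤ 8 * (a * min a ‖z‖⁻¹) * ‖z‖ ^ 2 := by
    refine h6.trans ?_
    rcases le_total ‖z * a‖ 1 with hle | hge
    · have h8 : ‖Complex.exp (-(z * a)) - 1 + z * a‖ ≤ ‖z * a‖ ^ 2 := by
        have := Complex.norm_exp_sub_one_sub_id_le (x := -(z * a)) (by rwa [norm_neg])
        rwa [norm_neg, sub_neg_eq_add] at this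
      have h9 : min a ‖z‖⁻¹ = a := by
        rw [min_eq_left]
        rw [le_inv_comm₀ ha hzn, ← one_div, le_div_iff₀ ha, ← hxn]; exact hle
      rw [h9]
      have : ‖z * a‖ * ‖Complex.exp (-(z * a)) - 1‖ ≤ ‖z * a‖ * ‖z * a‖ := by gcongr
      have h10 : 0 ≤ (‖z‖ * a) ^ 2 := by positivity
      rw [hxn] at *
      nlinarith
    · have h8 : ‖Complex.exp (-(z * a)) - 1 + z * a‖ ≤ 2 * ‖z * a‖ :=
        (norm_add_le _ _).trans (by linarith)
      have h9 : min a ‖z‖⁻¹ = ‖z‖⁻¹ := by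
        rw [min_eq_right]
        rw [inv_le_comm₀ hzn ha, ← one_div, div_le_iff₀ ha, ← hxn]; exact hge
      have h10 : ‖Complex.exp (-(z * a)) - 1‖ ≤ 2 := by
        refine (norm_sub_le _ _).trans ?_
        rw [Complex.norm_exp, Complex.neg_re, norm_one]
        have := Real.exp_le_one_iff.2 (neg_nonpos.2 hx)
        linarith
      rw [h9]
      have : ‖z * a‖ * ‖Complex.exp (-(z * a)) - 1‖ ≤ ‖z * a‖ * 2 := by gcongr
      have h11 : 8 * (a * ‖z‖⁻¹) * ‖z‖ ^ 2 = 8 * (‖z‖ * a) := by field_simp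
      rw [h11, ← hxn]
      linarith
  exact h7.trans (mul_le_mul_of_nonneg_right (by linarith) (by positivity))

theorem triangle_lower {a : ℝ} (ha : 0 < a) {z : ℂ} (hz : 0 < z.re) :
    a * min a ‖z‖⁻¹ - min a ‖z‖⁻¹ ^ 2 / 2 ≤
      4 * (((Complex.exp (-(z * a)) - 1 + z * a) / z ^ 2).re +
        500 * (z / ‖z‖ * ((Complex.exp (-(z * a)) - 1 + z * a) / z ^ 2)).re) := by
  have hz0 : z ≠ 0 := by rintro rfl; simp at hz
  have hzn : 0 < ‖z‖ := norm_pos_iff.2 hz0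
  have hzc : (‖z‖ : ℂ) ≠ 0 := by exact_mod_cast hzn.ne'
  refine (mul_min_le ha (inv_pos.2 hzn)).2.trans ?_
  have hx : 0 ≤ (z * a).re := by simp; positivity
  have hxn : ‖z * a‖ = ‖z‖ * a := by simp [abs_of_pos ha]
  have hrot : z / ‖z‖ * ((Complex.exp (-(z * a)) - 1 + z * a) / z ^ 2) =
      ((a / ‖z‖ : ℝ) : ℂ) + (Complex.exp (-(z * a)) - 1) / (z * ‖z‖) := by
    push_cast
    field_simp
    ring
  have hrotn : ∀ k, ‖Complex.exp (-(z * a)) - 1‖ ≤ k * ‖z * a‖ →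
      (1 - k) * (a / ‖z‖) ≤ (z / ‖z‖ * ((Complex.exp (-(z * a)) - 1 + z * a) / z ^ 2)).re := by
    intro k hk
    rw [hrot, Complex.add_re, Complex.ofReal_re]
    have h1 : ‖(Complex.exp (-(z * a)) - 1) / (z * ‖z‖)‖ ≤ k * (a / ‖z‖) := by
      rw [norm_div, norm_mul, Complex.norm_real, norm_norm, div_le_iff₀ (by positivity)]
      refine hk.trans (le_of_eq ?_)
      rw [hxn]
      field_simp
    have h2 := (abs_le.1 (Complex.abs_re_le_norm ((Complex.exp (-(z * a)) - 1) / (z * ‖z‖)))).1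
    linarith
  rcases le_total ‖z * a‖ 1 with hle | hge
  · have h9 : min a ‖z‖⁻¹ = a := by
      rw [min_eq_left]
      rw [le_inv_comm₀ ha hzn, ← one_div, le_div_iff₀ ha, ← hxn]; exact hle
    have h1 := hrotn 1 (by simpa using norm_exp_neg_sub_one_le hx)
    have h2 := Complex.exp_bound (x := -(z * a)) (by rwa [norm_neg]) (n := 3) (by norm_num)
    simp [Finset.sum_range_succ, Nat.factorial, -neg_mul] at h2
    have h3 : (Complex.exp (-(z * a)) - 1 + z * a) / z ^ 2 =
        ((a ^ 2 / 2 : ℝ) : ℂ) + (Complex.exp (-(z * a)) - (1 + -(z * a) + (z * a) ^ 2 / 2)) / z ^ 2 := by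
      push_cast
      field_simp
      ring
    have h4 : ‖(Complex.exp (-(z * a)) - (1 + -(z * a) + (z * a) ^ 2 / 2)) / z ^ 2‖ ≤
        2 / 9 * a ^ 2 := by
      rw [norm_div, norm_pow, div_le_iff₀ (by positivity)]
      refine h2.trans ?_
      rw [abs_of_pos ha]
      have : (‖z‖ * a) ^ 3 ≤ (‖z‖ * a) ^ 2 := by
        rw [hxn] at hle
        exact pow_le_pow_of_le_one (by positivity) hle (by norm_num)
      nlinarith
    have h5 := (abs_le.1 (Complex.abs_re_le_norm
      ((Complex.exp (-(z * a)) - (1 + -(z * a) + (z * a) ^ 2 / 2)) / z ^ 2))).1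
    have h6 : a ^ 2 / 2 - 2 / 9 * a ^ 2 ≤ ((Complex.exp (-(z * a)) - 1 + z * a) / z ^ 2).re := by
      rw [h3, Complex.add_re, Complex.ofReal_re]
      linarith
    rw [h9]
    nlinarith
  · have h9 : min a ‖z‖⁻¹ = ‖z‖⁻¹ := by
      rw [min_eq_right]
      rw [inv_le_comm₀ hzn ha, ← one_div, div_le_iff₀ ha, ← hxn]; exact hge
    have h1 := hrotn 0.993 (norm_exp_neg_sub_one_le_of_one_le hx hge)
    have h4 : ‖(Complex.exp (-(z * a)) - 1 + z * a) / z ^ 2‖ ≤ 2 * (a / ‖z‖) := by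
      rw [norm_div, norm_pow, div_le_iff₀ (by positivity)]
      have h8 : ‖Complex.exp (-(z * a)) - 1 + z * a‖ ≤ 2 * ‖z * a‖ :=
        (norm_add_le _ _).trans (by linarith [norm_exp_neg_sub_one_le hx])
      refine h8.trans (le_of_eq ?_)
      rw [hxn]
      field_simp
    have h5 := (abs_le.1 (Complex.abs_re_le_norm
      ((Complex.exp (-(z * a)) - 1 + z * a) / z ^ 2))).1
    rw [h9, ← div_eq_mul_inv]
    have : 0 < a / ‖z‖ := by positivity
    linarith

/-- `|b̂(z)|` dominates the primitive of `b` at `1 / |z|`. -/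
theorem primitive_le_norm_laplace (hb : Assumption1 b b' ρ) {z : ℂ} (hz : 0 < z.re) :
    ∫ u in (0 : ℝ)..‖z‖⁻¹, b u ≤ 2004 * ‖laplaceTransform b z‖ := by
  obtain ⟨ν, _, hpos, hν⟩ := hb.exists_triangle_measure
  have hz0 : z ≠ 0 := by rintro rfl; simp at hz
  have hzn : 0 < ‖z‖ := norm_pos_iff.2 hz0
  have h2 := integral_smul_of_triangle hν hb.nonneg
    (F := fun t : ℝ => Complex.exp (-z * t)) (by fun_prop) (hb.integrableOn_exp hz)
  have hker : ∀ᵐ a ∂ν, ∫ t in Ioi (0 : ℝ), max (a - t) 0 • Complex.exp (-z * t) =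
      (Complex.exp (-(z * a)) - 1 + z * a) / z ^ 2 := by
    filter_upwards [hpos] with a ha
    rw [setIntegral_triangle_smul ha, integral_triangle_exp hz0]
  have hi := h2.1.congr hker
  have he := h2.2.trans (integral_congr_ae hker)
  rw [← laplaceTransform_eq] at he
  have h3 := hb.primitive_repr hpos hν (inv_pos.2 hzn)
  have hre : (laplaceTransform b z).re =
      ∫ a, ((Complex.exp (-(z * a)) - 1 + z * a) / z ^ 2).re ∂ν := by
    rw [he]; exact (integral_re hi).symm
  have hre2 : (z / ‖z‖ * laplaceTransform b z).re =
      ∫ a, (z / ‖z‖ * ((Complex.exp (-(z * a)) - 1 + z * a) / z ^ 2)).re ∂ν := by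
    rw [he, ← integral_const_mul]; exact (integral_re (hi.const_mul _)).symm
  have hmain : ∫ u in (0 : ℝ)..‖z‖⁻¹, b u ≤
      4 * ((laplaceTransform b z).re + 500 * (z / ‖z‖ * laplaceTransform b z).re) := by
    have hi1 : Integrable (fun a : ℝ => ((Complex.exp (-(z * a)) - 1 + z * a) / z ^ 2).re) ν := hi.re
    have hi2 : Integrable (fun a : ℝ => 500 *
        (z / ‖z‖ * ((Complex.exp (-(z * a)) - 1 + z * a) / z ^ 2)).re) ν :=
      (hi.const_mul _).re.const_mul 500
    rw [hre, hre2, h3.2, ← integral_const_mul, ← integral_add hi1 hi2, ← integral_const_mul]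
    refine integral_mono_ae h3.1 ((hi1.add hi2).const_mul 4) ?_
    filter_upwards [hpos] with a ha
    exact triangle_lower ha hz
  have h5 := Complex.re_le_norm (laplaceTransform b z)
  have h6 := Complex.re_le_norm (z / ‖z‖ * laplaceTransform b z)
  rw [norm_mul, norm_div, Complex.norm_real, norm_norm, div_self hzn.ne', one_mul] at h6
  linarith

end Assumption1

theorem ae_fst_ne_snd : ∀ᵐ q : ℝ × ℝ, q.1 ≠ q.2 := by
  rw [Measure.volume_eq_prod, Measure.ae_prod_iff_ae_ae]
  · refine Eventually.of_forall fun x => ?_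
    filter_upwards [(Set.countable_singleton x).ae_notMem volume] with y hy h
    exact hy h.symm
  · exact (measurableSet_eq_fun measurable_fst measurable_snd).compl

/-- The symmetric quadratic form of a superposition of triangle kernels is nonnegative. -/
theorem integral_mul_triangle_nonneg {b : ℝ → ℝ} {ν : Measure ℝ} [SFinite ν]
    (hν : ∀ t > 0, ∫⁻ a, ENNReal.ofReal (a - t) ∂ν = ENNReal.ofReal (b t))
    (hb : ∀ t > 0, 0 ≤ b t) {f : ℝ → ℝ} (hf : Measurable f)
    (hi : Integrable fun q : ℝ × ℝ => f q.1 * f q.2 * b |q.1 - q.2|) :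
    0 ≤ ∫ q : ℝ × ℝ, f q.1 * f q.2 * b |q.1 - q.2| := by
  set D : Set ((ℝ × ℝ) × (ℝ × ℝ)) := {x | x.2.2 < x.1.1 ∧ x.1.1 < x.2.2 + x.2.1 ∧
    x.2.2 < x.1.2 ∧ x.1.2 < x.2.2 + x.2.1} with hD
  have hDm : MeasurableSet D := by
    refine (measurableSet_lt (f := fun x : (ℝ × ℝ) × (ℝ × ℝ) => x.2.2) (g := fun x => x.1.1)
      ?_ ?_).inter ((measurableSet_lt (f := fun x : (ℝ × ℝ) × (ℝ × ℝ) => x.1.1)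
      (g := fun x => x.2.2 + x.2.1) ?_ ?_).inter
      ((measurableSet_lt (f := fun x : (ℝ × ℝ) × (ℝ × ℝ) => x.2.2) (g := fun x => x.1.2)
      ?_ ?_).inter (measurableSet_lt (f := fun x : (ℝ × ℝ) × (ℝ × ℝ) => x.1.2)
      (g := fun x => x.2.2 + x.2.1) ?_ ?_)))
    all_goals fun_prop
  have hne := ae_fst_ne_snd
  have hlin : ∀ q : ℝ × ℝ, q.1 ≠ q.2 →
      (ν.prod volume) (Prod.mk q ⁻¹' D) = ENNReal.ofReal (b |q.1 - q.2|) := by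
    rintro ⟨t, u⟩ hq
    have hq : t ≠ u := hq
    rw [Measure.prod_apply (measurable_prodMk_left hDm), ← hν _ (abs_pos.2 (sub_ne_zero.2 hq))]
    refine lintegral_congr fun a => ?_
    have : Prod.mk a ⁻¹' (Prod.mk (t, u) ⁻¹' D) = Ioo (max t u - a) (min t u) := by
      ext v
      simp only [hD, mem_preimage, mem_ofPred_eq, mem_Ioo, lt_min_iff, sub_lt_iff_lt_add, max_lt_iff]
      tauto
    rw [this, Real.volume_Ioo]
    congr 1
    rw [← max_sub_min_eq_abs']
    ring
  have hint : ∀ q : ℝ × ℝ, q.1 ≠ q.2 →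
      Integrable ((Prod.mk q ⁻¹' D).indicator fun _ => (1 : ℝ)) (ν.prod volume) := fun q hq => by
    rw [integrable_indicator_iff (measurable_prodMk_left hDm), integrableOn_const_iff (by simp)]
    exact Or.inr (by rw [hlin q hq]; exact ENNReal.ofReal_lt_top)
  have hval : ∀ q : ℝ × ℝ, q.1 ≠ q.2 →
      ∫ p, (Prod.mk q ⁻¹' D).indicator (fun _ => (1 : ℝ)) p ∂(ν.prod volume) = b |q.1 - q.2| :=
    fun q hq => by
      rw [integral_indicator_const _ (measurable_prodMk_left hDm), measureReal_def, hlin q hq,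
        ENNReal.toReal_ofReal (hb _ (abs_pos.2 (sub_ne_zero.2 hq))), smul_eq_mul, mul_one]
  have hind : ∀ q p, (Prod.mk q ⁻¹' D).indicator (fun _ => (1 : ℝ)) p =
      D.indicator (fun _ => (1 : ℝ)) (q, p) := fun q p => rfl
  have hG : Integrable (Function.uncurry fun (q : ℝ × ℝ) (p : ℝ × ℝ) =>
      f q.1 * f q.2 * D.indicator (fun _ => (1 : ℝ)) (q, p))
      ((volume : Measure (ℝ × ℝ)).prod (ν.prod volume)) := by
    have hm : Measurable (Function.uncurry fun (q : ℝ × ℝ) (p : ℝ × ℝ) =>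
      f q.1 * f q.2 * D.indicator (fun _ => (1 : ℝ)) (q, p)) := by
      refine Measurable.mul (by fun_prop) (measurable_const.indicator hDm)
    rw [integrable_prod_iff hm.aestronglyMeasurable]
    refine ⟨?_, hi.norm.congr ?_⟩
    · filter_upwards [hne] with q hq
      exact (hint q hq).const_mul (f q.1 * f q.2)
    · filter_upwards [hne] with q hq
      simp only [Function.uncurry, norm_mul, Real.norm_eq_abs]
      rw [integral_const_mul, abs_of_nonneg (hb _ (abs_pos.2 (sub_ne_zero.2 hq))), ← hval q hq]
      congr 1
      refine integral_congr_ae (Eventually.of_forall fun p => ?_)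
      dsimp only
      rw [hind, abs_of_nonneg (indicator_nonneg (fun _ _ => zero_le_one) _)]
  calc (0 : ℝ) ≤ ∫ p, (∫ q : ℝ × ℝ, f q.1 * f q.2 * D.indicator (fun _ => (1 : ℝ)) (q, p))
        ∂(ν.prod volume) := integral_nonneg fun p => by
        have : ∀ q : ℝ × ℝ, f q.1 * f q.2 * D.indicator (fun _ => (1 : ℝ)) (q, p) =
            (Ioo p.2 (p.2 + p.1)).indicator f q.1 * (Ioo p.2 (p.2 + p.1)).indicator f q.2 := by
          intro q
          simp only [indicator, hD, mem_ofPred_eq, mem_Ioo]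
          split_ifs <;> first | tauto | simp
        simp only [this]
        rw [Measure.volume_eq_prod, integral_prod_mul]
        exact mul_self_nonneg (∫ x, (Ioo p.2 (p.2 + p.1)).indicator f x)
    _ = ∫ q : ℝ × ℝ, ∫ p, f q.1 * f q.2 * D.indicator (fun _ => (1 : ℝ)) (q, p)
        ∂(ν.prod volume) := (integral_integral_swap hG).symm
    _ = _ := integral_congr_ae (by
        filter_upwards [hne] with q hq
        rw [integral_const_mul, ← hval q hq]
        rfl)

namespace Assumption1
variable {b b' : ℝ → ℝ} {ρ : ℝ}

/-- The kernel `b` is of positive type. -/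
theorem integral_mul_conv_nonneg (hb : Assumption1 b b' ρ) {f : ℝ → ℝ} {T : ℝ} (hT : 0 < T)
    (hf : ContinuousOn f (Icc 0 T)) :
    0 ≤ ∫ t in (0 : ℝ)..T, f t * ∫ u in (0 : ℝ)..t, b (t - u) * f u := by
  obtain ⟨ν, _, -, hν⟩ := hb.exists_triangle_measure
  obtain ⟨M, hM⟩ := isCompact_Icc.exists_bound_of_continuousOn hf
  set F := (Ioc 0 T).indicator f with hF
  set k := (Ioc 0 T).indicator b with hk
  have hFi : Integrable F := (integrable_indicator_iff measurableSet_Ioc).2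
    (hf.integrableOn_Icc.mono_set Ioc_subset_Icc_self)
  have hki : Integrable k := (integrable_indicator_iff measurableSet_Ioc).2 (hb.locInt T hT)
  have hFm : Measurable F := by
    classical
    rw [hF, ← piecewise_eq_indicator]
    exact (hf.mono Ioc_subset_Icc_self).measurable_piecewise continuousOn_const measurableSet_Ioc
  have hFb : ∀ t, ‖F t‖ ≤ M := by
    intro t
    by_cases ht : t ∈ Ioc 0 T
    · rw [hF, indicator_of_mem ht]; exact hM t (Ioc_subset_Icc_self ht)
    · rw [hF, indicator_of_notMem ht, norm_zero]
      exact (norm_nonneg _).trans (hM 0 ⟨le_rfl, hT.le⟩)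
  have h1 : Integrable (fun q : ℝ × ℝ => F q.1 * (F q.2 * k (q.1 - q.2))) := by
    have := hFi.convolution_integrand (ContinuousLinearMap.mul ℝ ℝ) hki
    simp only [ContinuousLinearMap.mul_apply'] at this
    refine Integrable.bdd_mul (c := M) this (hFm.comp measurable_fst).aestronglyMeasurable
      (Eventually.of_forall fun q => hFb _)
  have h2 : Integrable (fun q : ℝ × ℝ => F q.2 * (F q.1 * k (q.2 - q.1))) := h1.swap
  have h3 : ∫ q : ℝ × ℝ, F q.2 * (F q.1 * k (q.2 - q.1)) =
      ∫ q : ℝ × ℝ, F q.1 * (F q.2 * k (q.1 - q.2)) :=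
    integral_prod_swap (μ := volume) (ν := volume) fun q : ℝ × ℝ => F q.1 * (F q.2 * k (q.1 - q.2))
  have hzero : ∀ t ∉ Ioc 0 T, F t = 0 := fun t ht => indicator_of_notMem ht _
  have h4 : ∀ t u, t < u → F t * (F u * k (t - u)) + F u * (F t * k (u - t)) =
      F t * F u * b (u - t) := by
    intro t u htu
    by_cases ht : t ∈ Ioc 0 T
    · by_cases hu : u ∈ Ioc 0 T
      · have hk1 : k (t - u) = 0 := indicator_of_notMem (fun h => by linarith [h.1]) _
        have hk2 : k (u - t) = b (u - t) :=
          indicator_of_mem (mem_Ioc.2 ⟨by linarith, by linarith [hu.2, ht.1]⟩) _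
        rw [hk1, hk2]; ring
      · simp [hzero u hu]
    · simp [hzero t ht]
  have h5 : ∀ᵐ q : ℝ × ℝ, F q.1 * (F q.2 * k (q.1 - q.2)) + F q.2 * (F q.1 * k (q.2 - q.1)) =
      F q.1 * F q.2 * b |q.1 - q.2| := by
    filter_upwards [ae_fst_ne_snd] with q hq
    rcases lt_or_gt_of_ne hq with h | h
    · rw [h4 _ _ h, abs_sub_comm, abs_of_pos (sub_pos.2 h)]
    · rw [add_comm, h4 _ _ h, abs_of_pos (sub_pos.2 h), mul_comm (F q.2)]
  have h6 := integral_mul_triangle_nonneg hν hb.nonneg hFm ((h1.add h2).congr h5)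
  rw [← integral_congr_ae h5, integral_add h1 h2, h3] at h6
  have h7 : ∫ q : ℝ × ℝ, F q.1 * (F q.2 * k (q.1 - q.2)) =
      ∫ t in (0 : ℝ)..T, f t * ∫ u in (0 : ℝ)..t, b (t - u) * f u := by
    rw [Measure.volume_eq_prod, integral_prod _ h1, intervalIntegral.integral_of_le hT.le,
      ← integral_indicator measurableSet_Ioc]
    refine integral_congr_ae (Eventually.of_forall fun t => ?_)
    by_cases ht : t ∈ Ioc 0 T
    · dsimp only
      rw [integral_const_mul, indicator_of_mem ht, hF, indicator_of_mem ht,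
        intervalIntegral.integral_of_le ht.1.le, integral_Ioc_eq_integral_Ioo,
        ← integral_indicator measurableSet_Ioo]
      congr 2 with u
      by_cases hu : u ∈ Ioo 0 t
      · rw [indicator_of_mem hu, indicator_of_mem (mem_Ioc.2 ⟨hu.1, hu.2.le.trans ht.2⟩), hk,
          indicator_of_mem (mem_Ioc.2 ⟨by linarith [hu.2], by linarith [hu.1, ht.2]⟩), mul_comm]
      · rw [indicator_of_notMem hu]
        by_cases hu0 : 0 < u
        · rw [hk, indicator_of_notMem (a := t - u), mul_zero]
          exact fun h => hu ⟨hu0, by linarith [h.1]⟩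
        · rw [indicator_of_notMem (a := u), zero_mul]
          exact fun h => hu0 h.1
    · rw [indicator_of_notMem ht]
      simp [hzero t ht]
  linarith

end Assumption1

theorem Assumption1.intervalIntegrable {b b' : ℝ → ℝ} {ρ : ℝ} (hb : Assumption1 b b' ρ) {t : ℝ}
    (ht : 0 ≤ t) : IntervalIntegrable b volume 0 t := by
  rcases ht.eq_or_lt with rfl | ht
  · simp
  · exact (intervalIntegrable_iff_integrableOn_Ioc_of_le ht.le).2 (hb.locInt t ht)

theorem Assumption1.abs_integral_conv_le {b b' f : ℝ → ℝ} {ρ M t : ℝ} (hb : Assumption1 b b' ρ)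
    (ht : 0 ≤ t) (hf : ∀ u ∈ Ioc 0 t, |f u| ≤ M) :
    |∫ u in (0 : ℝ)..t, b (t - u) * f u| ≤ M * ∫ u in (0 : ℝ)..t, b u := by
  have hi : IntervalIntegrable (fun u => b (t - u)) volume 0 t := by
    simpa using ((hb.intervalIntegrable ht).comp_sub_left t).symm
  have h1 : ∫ u in (0 : ℝ)..t, b u = ∫ u in (0 : ℝ)..t, b (t - u) := by
    simp
  rw [← Real.norm_eq_abs, h1, ← intervalIntegral.integral_const_mul,
    intervalIntegral.integral_of_le ht, intervalIntegral.integral_of_le ht,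
    integral_Ioc_eq_integral_Ioo, integral_Ioc_eq_integral_Ioo]
  have hi2 : IntegrableOn (fun u => M * b (t - u)) (Ioo 0 t) :=
    (((intervalIntegrable_iff_integrableOn_Ioc_of_le ht).1 hi).mono_set Ioo_subset_Ioc_self).const_mul M
  refine norm_integral_le_of_norm_le hi2 ?_
  refine (ae_restrict_iff' measurableSet_Ioo).2 (Eventually.of_forall fun u hu => ?_)
  have := hb.nonneg (t - u) (by linarith [hu.2])
  rw [norm_mul, Real.norm_of_nonneg this, mul_comm]
  exact mul_le_mul_of_nonneg_right (hf u ⟨hu.1, hu.2.le⟩) this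

theorem Assumption1.primitive_mono {b b' : ℝ → ℝ} {ρ : ℝ} (hb : Assumption1 b b' ρ) {t T : ℝ}
    (ht : 0 ≤ t) (htT : t ≤ T) : ∫ u in (0 : ℝ)..t, b u ≤ ∫ u in (0 : ℝ)..T, b u := by
  refine intervalIntegral.integral_mono_interval le_rfl ht htT ?_
    (hb.intervalIntegrable (ht.trans htT))
  exact (ae_restrict_iff' measurableSet_Ioc).2 (Eventually.of_forall fun u hu => hb.nonneg u hu.1)

namespace IsScalarSolution
variable {b b' s s' : ℝ → ℝ} {ρ lam : ℝ}

theorem deriv_eq (hs : IsScalarSolution b lam s s') {t : ℝ} (ht : 0 < t) :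
    s' t = -lam * ∫ u in (0 : ℝ)..t, b (t - u) * s u := by
  linarith [hs.eqn t ht]

theorem deriv_eq_conv (hs : IsScalarSolution b lam s s') {x : ℝ} (hx : 0 < x) :
    s' x = -lam * ∫ v in (0 : ℝ)..x, b v * s (x - v) := by
  rw [hs.deriv_eq hx]
  congr 1
  simpa using intervalIntegral.integral_comp_sub_left (fun v => b v * s (x - v)) x
    (a := 0) (b := x)

theorem aestronglyMeasurable_deriv (hs : IsScalarSolution b lam s s') :
    AEStronglyMeasurable s' (volume.restrict (Ioi 0)) :=
  (measurable_deriv s).aestronglyMeasurable.congr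
    ((ae_restrict_iff' measurableSet_Ioi).2 (Eventually.of_forall fun t ht =>
      (hs.hasDeriv t ht).deriv))

theorem abs_deriv_le_of_abs_le (hs : IsScalarSolution b lam s s')
    (hb : Assumption1 b b' ρ) (hlam : 0 < lam) {M t : ℝ} (ht : 0 < t)
    (hM : ∀ u ∈ Ioc 0 t, |s u| ≤ M) : |s' t| ≤ lam * (M * ∫ u in (0 : ℝ)..t, b u) := by
  rw [hs.deriv_eq ht, abs_mul, abs_neg, abs_of_pos hlam]
  exact mul_le_mul_of_nonneg_left (hb.abs_integral_conv_le ht.le hM) hlam.le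

theorem abs_le_one (hs : IsScalarSolution b lam s s')
    (hb : Assumption1 b b' ρ) (hlam : 0 < lam) {T : ℝ} (hT : 0 ≤ T) : |s T| ≤ 1 := by
  rcases hT.eq_or_lt with rfl | hT
  · rw [hs.init, abs_one]
  have hc : ContinuousOn s (Icc 0 T) := hs.cont.mono Icc_subset_Ici_self
  obtain ⟨M, hM⟩ := isCompact_Icc.exists_bound_of_continuousOn hc
  have hM0 : 0 ≤ M := (norm_nonneg _).trans (hM 0 ⟨le_rfl, hT.le⟩)
  have hi : IntervalIntegrable (fun t => s t * s' t) volume 0 T := by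
    rw [intervalIntegrable_iff_integrableOn_Ioc_of_le hT.le]
    refine IntegrableOn.of_bound (by simp)
      ((hc.mono Ioc_subset_Icc_self).aestronglyMeasurable measurableSet_Ioc |>.mul
        (hs.aestronglyMeasurable_deriv.mono_set Ioc_subset_Ioi_self))
      (M * (lam * (M * ∫ u in (0 : ℝ)..T, b u))) ?_
    refine (ae_restrict_iff' measurableSet_Ioc).2 (Eventually.of_forall fun t ht => ?_)
    rw [norm_mul]
    refine mul_le_mul (hM t (Ioc_subset_Icc_self ht)) ?_ (norm_nonneg _) hM0
    refine (hs.abs_deriv_le_of_abs_le hb hlam ht.1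
      fun u hu => hM u ⟨hu.1.le, hu.2.trans ht.2⟩).trans ?_
    have := hb.primitive_mono ht.1.le ht.2
    gcongr
  have h1 := intervalIntegral.integral_eq_sub_of_hasDerivAt_of_le hT.le (f := fun t => s t ^ 2)
    (f' := fun t => 2 * (s t * s' t)) (hc.pow 2)
    (fun t ht => ((hs.hasDeriv t ht.1).pow 2).congr_deriv (by simp; ring)) (hi.const_mul 2)
  have h2 : ∫ t in (0 : ℝ)..T, 2 * (s t * s' t) =
      -(2 * lam) * ∫ t in (0 : ℝ)..T, s t * ∫ u in (0 : ℝ)..t, b (t - u) * s u := by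
    rw [← intervalIntegral.integral_const_mul, intervalIntegral.integral_of_le hT.le,
      intervalIntegral.integral_of_le hT.le]
    refine setIntegral_congr_fun measurableSet_Ioc fun t ht => ?_
    rw [hs.deriv_eq ht.1]
    ring
  have h3 := hb.integral_mul_conv_nonneg hT hc
  rw [h2, hs.init] at h1
  rw [← sq_le_one_iff_abs_le_one]
  nlinarith

theorem abs_deriv_le (hs : IsScalarSolution b lam s s')
    (hb : Assumption1 b b' ρ) (hlam : 0 < lam) {t : ℝ} (ht : 0 < t) :
    |s' t| ≤ lam * ∫ u in (0 : ℝ)..t, b u := by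
  simpa using hs.abs_deriv_le_of_abs_le hb hlam ht (M := 1) fun u hu => hs.abs_le_one hb hlam hu.1.le

theorem measurable_indicator (hs : IsScalarSolution b lam s s') :
    Measurable ((Ici 0).indicator s) := by
  classical
  rw [← piecewise_eq_indicator]
  exact hs.cont.measurable_piecewise continuousOn_const measurableSet_Ici

theorem continuousAt_deriv (hs : IsScalarSolution b lam s s') (hb : Assumption1 b b' ρ)
    (hlam : 0 < lam) {t : ℝ} (ht : 0 < t) : ContinuousAt s' t := by
  have h1 : ∀ x ∈ Ioo 0 (t + 1), s' x =
      -lam * ∫ v in Ioc 0 (t + 1), b v * (Ici 0).indicator s (x - v) := by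
    intro x hx
    rw [hs.deriv_eq_conv hx.1, intervalIntegral.integral_of_le hx.1.le,
      setIntegral_eq_of_subset_of_forall_sdiff_eq_zero
      (s := Ioc 0 x) (t := Ioc 0 (t + 1)) measurableSet_Ioc (Ioc_subset_Ioc_right hx.2.le)]
    · congr 1
      refine setIntegral_congr_fun measurableSet_Ioc fun v hv => ?_
      rw [indicator_of_mem (mem_Ici.2 (by linarith [hv.2]))]
    · intro v hv
      rw [indicator_of_notMem, mul_zero]
      intro h
      exact hv.2 ⟨hv.1.1, by linarith [mem_Ici.1 h]⟩
  have h2 : s' =ᶠ[nhds t] fun x => -lam * ∫ v in Ioc 0 (t + 1), b v * (Ici 0).indicator s (x - v) :=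
    eventually_of_mem (Ioo_mem_nhds ht (by linarith)) h1
  refine ContinuousAt.congr (continuousAt_const.mul ?_) h2.symm
  have hbi : IntegrableOn b (Ioc 0 (t + 1)) := hb.locInt _ (by linarith)
  refine continuousAt_of_dominated (bound := fun v => ‖b v‖) ?_ ?_ hbi.norm ?_
  · refine Eventually.of_forall fun x => hbi.aestronglyMeasurable.mul ?_
    exact (hs.measurable_indicator.comp (measurable_const.sub measurable_id)).aestronglyMeasurable
  · refine Eventually.of_forall fun x => Eventually.of_forall fun v => ?_
    rw [norm_mul]
    refine mul_le_of_le_one_right (norm_nonneg _) ?_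
    by_cases h : x - v ∈ Ici 0
    · rw [indicator_of_mem h]; exact hs.abs_le_one hb hlam h
    · rw [indicator_of_notMem h]; simp
  · filter_upwards [ae_restrict_of_ae ((Set.countable_singleton t).ae_notMem volume)] with v hv
    refine continuousAt_const.mul ?_
    rcases lt_or_gt_of_ne (show v ≠ t from hv) with h | h
    · have : ContinuousAt s (t - v) := (hs.hasDeriv _ (sub_pos.2 h)).continuousAt
      have h3 : (Ici 0).indicator s =ᶠ[nhds (t - v)] s :=
        eventually_of_mem (Ici_mem_nhds (sub_pos.2 h)) fun x hx => indicator_of_mem hx _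
      exact ContinuousAt.comp' (g := (Ici 0).indicator s) (this.congr h3.symm) (by fun_prop)
    · have h3 : (Ici 0).indicator s =ᶠ[nhds (t - v)] fun _ => 0 :=
        eventually_of_mem (Iio_mem_nhds (sub_neg.2 h)) fun x hx =>
          indicator_of_notMem (not_le.2 hx) _
      exact ContinuousAt.comp' (g := (Ici 0).indicator s) (continuousAt_const.congr h3.symm)
        (by fun_prop)

end IsScalarSolution

theorem integral_Ioi_conv_mul {f g : ℝ → ℂ} (hf : IntegrableOn f (Ioi 0))
    (hg : IntegrableOn g (Ioi 0)) :
    IntegrableOn (fun x => ∫ t in (0 : ℝ)..x, f t * g (x - t)) (Ioi 0) ∧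
      ∫ x in Ioi (0 : ℝ), ∫ t in (0 : ℝ)..x, f t * g (x - t) =
        (∫ t in Ioi (0 : ℝ), f t) * ∫ t in Ioi (0 : ℝ), g t := by
  have h := integral_posConvolution hf hg (ContinuousLinearMap.mul ℝ ℂ)
  have h2 := integrable_posConvolution hf hg (ContinuousLinearMap.mul ℝ ℂ)
  simp only [posConvolution, integrable_indicator_iff measurableSet_Ioi,
    ContinuousLinearMap.mul_apply'] at h h2
  exact ⟨h2, h⟩

theorem hasDerivAt_exp_neg_mul_ofReal (z : ℂ) (t : ℝ) :
    HasDerivAt (fun t : ℝ => Complex.exp (-z * t)) (-z * Complex.exp (-z * t)) t := by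
  have h := ((hasDerivAt_id (t : ℂ)).const_mul (-z)).cexp.comp_ofReal
  exact h.congr_deriv (by simp; ring)

theorem tendsto_exp_neg_mul_atTop {η : ℝ} (hη : 0 < η) :
    Tendsto (fun t => Real.exp (-η * t)) atTop (nhds 0) :=
  Real.tendsto_exp_atBot.comp (tendsto_id.const_mul_atTop_of_neg (neg_lt_zero.2 hη))

namespace IsScalarSolution
variable {b b' s s' : ℝ → ℝ} {ρ lam : ℝ}

theorem aestronglyMeasurable (hs : IsScalarSolution b lam s s') :
    AEStronglyMeasurable s (volume.restrict (Ioi 0)) :=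
  (hs.cont.mono Ioi_subset_Ici_self).aestronglyMeasurable measurableSet_Ioi

theorem integrableOn_exp (hs : IsScalarSolution b lam s s') (hb : Assumption1 b b' ρ)
    (hlam : 0 < lam) {z : ℂ} (hz : 0 < z.re) :
    IntegrableOn (fun t => s t • Complex.exp (-z * t)) (Ioi 0) :=
  integrableOn_smul_exp hs.aestronglyMeasurable
    ((hs.cont.mono Icc_subset_Ici_self).integrableOn_Icc.mono_set Ioc_subset_Icc_self)
    (fun t ht => hs.abs_le_one hb hlam (by linarith)) hz

theorem integrableOn_mul_exp (hs : IsScalarSolution b lam s s') (hb : Assumption1 b b' ρ)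
    (hlam : 0 < lam) {z : ℂ} (hz : 0 < z.re) :
    IntegrableOn (fun t => s t • (t * Complex.exp (-z * t))) (Ioi 0) :=
  integrableOn_smul_mul_exp hs.aestronglyMeasurable
    ((hs.cont.mono Icc_subset_Ici_self).integrableOn_Icc.mono_set Ioc_subset_Icc_self)
    (fun t ht => hs.abs_le_one hb hlam (by linarith)) hz

theorem intervalIntegrable_conv (hs : IsScalarSolution b lam s s') (hb : Assumption1 b b' ρ)
    {x : ℝ} (hx : 0 < x) : IntervalIntegrable (fun v => b v * s (x - v)) volume 0 x := by
  refine (hb.intervalIntegrable hx.le).mul_continuousOn ?_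
  refine hs.cont.comp (by fun_prop) fun v hv => ?_
  rw [uIcc_of_le hx.le] at hv
  exact sub_nonneg.2 hv.2

theorem deriv_smul_exp (hs : IsScalarSolution b lam s s') (z : ℂ) {x : ℝ} (hx : 0 < x) :
    s' x • Complex.exp (-z * x) = -lam * ∫ t in (0 : ℝ)..x,
      (b t • Complex.exp (-z * t)) * (s (x - t) • Complex.exp (-z * (x - t : ℝ))) := by
  have : ∀ t : ℝ, (b t • Complex.exp (-z * t)) * (s (x - t) • Complex.exp (-z * (x - t : ℝ))) =
      ((b t * s (x - t) : ℝ) : ℂ) * Complex.exp (-z * x) := by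
    intro t
    have he : Complex.exp (-z * x) = Complex.exp (-z * t) * Complex.exp (-z * (x - t : ℝ)) := by
      rw [← Complex.exp_add]; push_cast; ring_nf
    rw [he, Complex.real_smul, Complex.real_smul]
    push_cast
    ring
  simp only [this]
  rw [intervalIntegral.integral_mul_const, intervalIntegral.integral_ofReal, hs.deriv_eq_conv hx,
    Complex.real_smul]
  push_cast
  ring

theorem deriv_smul_mul_exp (hs : IsScalarSolution b lam s s') (hb : Assumption1 b b' ρ) (z : ℂ)
    {x : ℝ} (hx : 0 < x) :
    s' x • (x * Complex.exp (-z * x)) = -lam * ((∫ t in (0 : ℝ)..x,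
      (b t • (t * Complex.exp (-z * t))) * (s (x - t) • Complex.exp (-z * (x - t : ℝ)))) +
      ∫ t in (0 : ℝ)..x, (b t • Complex.exp (-z * t)) *
        (s (x - t) • ((x - t : ℝ) * Complex.exp (-z * (x - t : ℝ))))) := by
  have he : ∀ t : ℝ, Complex.exp (-z * x) = Complex.exp (-z * t) * Complex.exp (-z * (x - t : ℝ)) := by
    intro t
    rw [← Complex.exp_add]; push_cast; ring_nf
  have h1 : ∀ t : ℝ, (b t • (t * Complex.exp (-z * t))) *
      (s (x - t) • Complex.exp (-z * (x - t : ℝ))) =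
      ((b t * s (x - t) : ℝ) : ℂ) * (t * Complex.exp (-z * x)) := by
    intro t
    rw [he t, Complex.real_smul, Complex.real_smul]
    push_cast
    ring
  have h2 : ∀ t : ℝ, (b t • Complex.exp (-z * t)) *
      (s (x - t) • ((x - t : ℝ) * Complex.exp (-z * (x - t : ℝ)))) =
      ((b t * s (x - t) : ℝ) : ℂ) * ((x - t : ℝ) * Complex.exp (-z * x)) := by
    intro t
    rw [he t, Complex.real_smul, Complex.real_smul]
    push_cast
    ring
  have hi : IntervalIntegrable (fun t => ((b t * s (x - t) : ℝ) : ℂ)) volume 0 x :=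
    ⟨(hs.intervalIntegrable_conv hb hx).1.ofReal, (hs.intervalIntegrable_conv hb hx).2.ofReal⟩
  simp only [h1, h2]
  rw [← intervalIntegral.integral_add (hi.mul_continuousOn (by fun_prop))
    (hi.mul_continuousOn (by fun_prop))]
  have h3 : ∀ t : ℝ, ((b t * s (x - t) : ℝ) : ℂ) * (t * Complex.exp (-z * x)) +
      ((b t * s (x - t) : ℝ) : ℂ) * ((x - t : ℝ) * Complex.exp (-z * x)) =
      ((b t * s (x - t) : ℝ) : ℂ) * (x * Complex.exp (-z * x)) := by
    intro t; push_cast; ring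
  simp only [h3]
  rw [intervalIntegral.integral_mul_const, intervalIntegral.integral_ofReal, hs.deriv_eq_conv hx,
    Complex.real_smul]
  push_cast
  ring

/-- The Laplace transform of `t s'(t)` in terms of those of `b` and `t b(t)`. -/
theorem laplace_mul_deriv (hs : IsScalarSolution b lam s s') (hb : Assumption1 b b' ρ)
    (hlam : 0 < lam) {z : ℂ} (hz : 0 < z.re) :
    IntegrableOn (fun t => s' t • (t * Complex.exp (-z * t))) (Ioi 0) ∧
      (∫ t in Ioi (0 : ℝ), s' t • (t * Complex.exp (-z * t))) *
        (z + lam * laplaceTransform b z) ^ 2 =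
      -lam * (laplaceTransform b z +
        z * ∫ t in Ioi (0 : ℝ), b t • (t * Complex.exp (-z * t))) := by
  have hbi := hb.integrableOn_exp hz
  have hbi' := hb.integrableOn_mul_exp hz
  have hsi := hs.integrableOn_exp hb hlam hz
  have hsi' := hs.integrableOn_mul_exp hb hlam hz
  have c0 := integral_Ioi_conv_mul hbi hsi
  have c1 := integral_Ioi_conv_mul hbi' hsi
  have c2 := integral_Ioi_conv_mul hbi hsi'
  have i0 : IntegrableOn (fun t => s' t • Complex.exp (-z * t)) (Ioi 0) :=
    IntegrableOn.congr_fun (c0.1.const_mul (-lam : ℂ)) (fun t ht => (hs.deriv_smul_exp z ht).symm)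
      measurableSet_Ioi
  have i1 : IntegrableOn (fun t => s' t • (t * Complex.exp (-z * t))) (Ioi 0) :=
    IntegrableOn.congr_fun ((c1.1.add c2.1).const_mul (-lam : ℂ))
      (fun t ht => (hs.deriv_smul_mul_exp hb z ht).symm) measurableSet_Ioi
  have e0 : ∫ t in Ioi (0 : ℝ), s' t • Complex.exp (-z * t) = -lam * (laplaceTransform b z *
      ∫ t in Ioi (0 : ℝ), s t • Complex.exp (-z * t)) := by
    rw [Assumption1.laplaceTransform_eq, ← c0.2, ← integral_const_mul]
    exact setIntegral_congr_fun measurableSet_Ioi fun t ht => hs.deriv_smul_exp z ht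
  have e1 : ∫ t in Ioi (0 : ℝ), s' t • (t * Complex.exp (-z * t)) =
      -lam * ((∫ t in Ioi (0 : ℝ), b t • (t * Complex.exp (-z * t))) *
        (∫ t in Ioi (0 : ℝ), s t • Complex.exp (-z * t)) + laplaceTransform b z *
        ∫ t in Ioi (0 : ℝ), s t • (t * Complex.exp (-z * t))) := by
    rw [Assumption1.laplaceTransform_eq, ← c1.2, ← c2.2, ← integral_add c1.1 c2.1,
      ← integral_const_mul]
    exact setIntegral_congr_fun measurableSet_Ioi fun t ht => hs.deriv_smul_mul_exp hb z ht
  have p0 : (∫ t in Ioi (0 : ℝ), s' t • Complex.exp (-z * t)) =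
      z * (∫ t in Ioi (0 : ℝ), s t • Complex.exp (-z * t)) - 1 := by
    have h := integral_Ioi_of_hasDerivAt_of_tendsto (a := 0) (m := 0)
      (f := fun t => s t • Complex.exp (-z * t))
      (f' := fun t => s' t • Complex.exp (-z * t) - z * (s t • Complex.exp (-z * t)))
      ((hs.cont 0 (by simp)).smul (by fun_prop))
      (fun t ht => ((hs.hasDeriv t ht).smul (hasDerivAt_exp_neg_mul_ofReal z t)).congr_deriv
        (by simp only [Complex.real_smul]; ring))
      (i0.sub (hsi.const_mul z))
      (squeeze_zero_norm' (eventually_atTop.2 ⟨0, fun t ht => by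
        rw [norm_smul, norm_exp_neg_mul_ofReal]
        exact mul_le_of_le_one_left (Real.exp_nonneg _) (hs.abs_le_one hb hlam ht)⟩)
        (tendsto_exp_neg_mul_atTop hz))
    rw [integral_sub i0 (hsi.const_mul z), integral_const_mul, hs.init] at h
    simp only [Complex.ofReal_zero, mul_zero, Complex.exp_zero, one_smul] at h
    linear_combination h
  have p1 : (∫ t in Ioi (0 : ℝ), s' t • (t * Complex.exp (-z * t))) =
      z * (∫ t in Ioi (0 : ℝ), s t • (t * Complex.exp (-z * t))) -
        ∫ t in Ioi (0 : ℝ), s t • Complex.exp (-z * t) := by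
    have i2 : IntegrableOn (fun t => s' t • (t * Complex.exp (-z * t)) -
        z * (s t • (t * Complex.exp (-z * t)))) (Ioi 0) := i1.sub (hsi'.const_mul z)
    have h := integral_Ioi_of_hasDerivAt_of_tendsto (a := 0) (m := 0)
      (f := fun t => s t • (t * Complex.exp (-z * t)))
      (f' := fun t => s' t • (t * Complex.exp (-z * t)) - z * (s t • (t * Complex.exp (-z * t))) +
        s t • Complex.exp (-z * t))
      ((hs.cont 0 (by simp)).smul (by fun_prop))
      (fun t ht => ((hs.hasDeriv t ht).smul ((hasDerivAt_id t).ofReal_comp.mul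
        (hasDerivAt_exp_neg_mul_ofReal z t))).congr_deriv
        (by simp only [Complex.real_smul, id, Complex.ofReal_one, Pi.mul_apply]; ring))
      (i2.add hsi)
      (squeeze_zero_norm' (a := fun t => 2 / z.re * Real.exp (-(z.re / 2) * t)) (eventually_atTop.2 ⟨1, fun t ht => by
        have ht0 : 0 < t := by linarith
        rw [norm_smul]
        exact (mul_le_of_le_one_left (norm_nonneg _) (hs.abs_le_one hb hlam ht0.le)).trans
          (norm_mul_exp_neg_mul_ofReal_le hz ht0)⟩)
        (by simpa using (tendsto_exp_neg_mul_atTop (half_pos hz)).const_mul (2 / z.re)))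
    rw [integral_add i2 hsi, integral_sub i1 (hsi'.const_mul z),
      integral_const_mul] at h
    simp only [Complex.ofReal_zero, zero_mul, smul_zero, sub_zero] at h
    linear_combination h
  refine ⟨i1, ?_⟩
  generalize (∫ t in Ioi (0 : ℝ), s' t • (t * Complex.exp (-z * t))) = W at *
  generalize (∫ t in Ioi (0 : ℝ), s t • (t * Complex.exp (-z * t))) = T at *
  generalize (∫ t in Ioi (0 : ℝ), s t • Complex.exp (-z * t)) = S at *
  generalize (∫ t in Ioi (0 : ℝ), b t • (t * Complex.exp (-z * t))) = β at *
  generalize laplaceTransform b z = B at *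
  have hS : S * (z + lam * B) = 1 := by linear_combination e0 - p0
  have hT : T * (z + lam * B) = S - lam * β * S := by linear_combination e1 - p1
  calc W * (z + lam * B) ^ 2 = -lam * (β * (S * (z + lam * B)) * (z + lam * B) +
        B * (T * (z + lam * B)) * (z + lam * B)) := by rw [e1]; ring
    _ = -lam * (β * (z + lam * B) + B * (S * (z + lam * B)) * (1 - lam * β)) := by
        rw [hT, hS]; linear_combination (-lam * B * (1 - lam * β)) * hS
    _ = _ := by rw [hS]; ring

end IsScalarSolution

namespace Assumption1
variable {b b' : ℝ → ℝ} {ρ : ℝ}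

/-- The values of `b̂` lie in a sector strictly inside the right half-plane. -/
theorem exists_re_laplace_ge (hb : Assumption1 b b' ρ) :
    ∃ κ > 0, ∀ z : ℂ, 0 < z.re → κ * ‖laplaceTransform b z‖ ≤ (laplaceTransform b z).re := by
  have hπ := Real.pi_pos
  set θ := (ρ - 1) * Real.pi / 2 with hθ
  have h1 := hb.rho_mem.1
  have h2 := hb.rho_mem.2
  have hθ2 : θ < Real.pi / 2 := by nlinarith
  have hθ0 : 0 < θ := by rw [hθ]; have := sub_pos.2 h1; positivity
  refine ⟨Real.cos θ, Real.cos_pos_of_mem_Ioo ⟨by linarith, hθ2⟩, fun z hz => ?_⟩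
  have hle : |(laplaceTransform b z).arg| ≤ θ := by
    have h := le_csSup (s := {θ : ℝ | ∃ z : ℂ, 0 < z.re ∧ θ = |(laplaceTransform b z).arg|})
      ⟨Real.pi, by rintro _ ⟨w, -, rfl⟩; exact Complex.abs_arg_le_pi _⟩ ⟨z, hz, rfl⟩
    refine h.trans (le_of_eq ?_)
    have := hb.rho_eq
    rw [hθ, this]
    field_simp
    ring
  rw [← Complex.norm_mul_cos_arg, mul_comm, ← Real.cos_abs (Complex.arg _)]
  gcongr
  exact Real.cos_le_cos_of_nonneg_of_le_pi (abs_nonneg _) (by linarith) hle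

theorem exists_norm_add_le (hb : Assumption1 b b' ρ) :
    ∃ K > 0, ∀ lam : ℝ, 0 < lam → ∀ z : ℂ, 0 < z.re →
      ‖z‖ + lam * ∫ u in (0 : ℝ)..‖z‖⁻¹, b u ≤ K * ‖z + lam * laplaceTransform b z‖ := by
  obtain ⟨κ, hκ, h⟩ := hb.exists_re_laplace_ge
  refine ⟨2004 * (1 + 2 / κ), by positivity, fun lam hlam z hz => ?_⟩
  have h1 := h z hz
  have h2 := hb.primitive_le_norm_laplace hz
  set B := laplaceTransform b z
  have h3 : κ * (lam * ‖B‖) ≤ ‖z + lam * B‖ := by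
    refine le_trans ?_ (Complex.re_le_norm _)
    rw [Complex.add_re, Complex.re_ofReal_mul]
    nlinarith
  have h4 : lam * ‖B‖ ≤ ‖z + lam * B‖ / κ := by
    rw [le_div_iff₀ hκ, mul_comm]; exact h3
  have h5 : ‖z‖ ≤ ‖z + lam * B‖ + lam * ‖B‖ := by
    have := norm_sub_le (z + lam * B) (lam * B)
    rwa [add_sub_cancel_right, norm_mul, Complex.norm_real, Real.norm_of_nonneg hlam.le] at this
  have h6 := mul_le_mul_of_nonneg_left h2 hlam.le
  have h7 : (2004 * (1 + 2 / κ)) * ‖z + lam * B‖ =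
      2004 * (‖z + lam * B‖ + 2 * (‖z + lam * B‖ / κ)) := by ring
  have := norm_nonneg z
  rw [h7]
  linarith

theorem primitive_nonneg (hb : Assumption1 b b' ρ) {t : ℝ} (ht : 0 ≤ t) :
    0 ≤ ∫ u in (0 : ℝ)..t, b u := by
  simpa using hb.primitive_mono le_rfl ht

theorem exists_primitive_eq (hb : Assumption1 b b' ρ) {lam : ℝ} (hlam : 0 < lam) :
    ∃ ω > 0, lam * ∫ u in (0 : ℝ)..ω⁻¹, b u = ω := by
  obtain ⟨t, ht, hbt⟩ := hb.ne_zero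
  have hbt : 0 < b t := lt_of_le_of_ne (hb.nonneg t ht) hbt.symm
  have hP : 0 < ∫ u in (0 : ℝ)..t, b u := by
    have : ∫ u in (0 : ℝ)..t, b t ≤ ∫ u in (0 : ℝ)..t, b u := by
      refine intervalIntegral.integral_mono_on_of_le_Ioo ht.le (by simp)
        (hb.intervalIntegrable ht.le) fun u hu => hb.anti hu.1 ht hu.2.le
    refine lt_of_lt_of_le ?_ this
    rw [intervalIntegral.integral_const, sub_zero, smul_eq_mul]
    positivity
  set T := max t (1 / (lam * ∫ u in (0 : ℝ)..t, b u)) with hT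
  have hT0 : 0 < T := lt_max_of_lt_left ht
  have hc : ContinuousOn (fun τ => lam * τ * ∫ u in (0 : ℝ)..τ, b u) (Icc 0 T) := by
    refine ContinuousOn.mul (by fun_prop) ?_
    have := intervalIntegral.continuousOn_primitive_interval (f := b) (μ := volume) (a := 0) (b := T)
      (by rw [uIcc_of_le hT0.le, integrableOn_Icc_iff_integrableOn_Ioc]; exact hb.locInt T hT0)
    rwa [uIcc_of_le hT0.le] at this
  have h1 : (1 : ℝ) ∈ Icc (lam * 0 * ∫ u in (0 : ℝ)..0, b u) (lam * T * ∫ u in (0 : ℝ)..T, b u) := by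
    refine ⟨by simp, ?_⟩
    calc (1 : ℝ) = lam * (1 / (lam * ∫ u in (0 : ℝ)..t, b u)) * ∫ u in (0 : ℝ)..t, b u := by
          field_simp
      _ ≤ _ := by
          have := hb.primitive_mono ht.le (le_max_left t (1 / (lam * ∫ u in (0 : ℝ)..t, b u)))
          gcongr
          exact le_max_right _ _
  obtain ⟨τ, hτ, he⟩ := intermediate_value_Icc hT0.le hc h1
  have hτ0 : 0 < τ := lt_of_le_of_ne hτ.1 (by rintro rfl; simp at he)
  refine ⟨τ⁻¹, inv_pos.2 hτ0, ?_⟩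
  rw [inv_inv]
  refine eq_inv_of_mul_eq_one_left ?_
  rw [← he]
  ring

end Assumption1

theorem div_add_sq_le {F : ℝ → ℝ} {r ω : ℝ} (hr : 0 < r) (hω : 0 < ω) (hF : 0 ≤ F r)
    (hanti : AntitoneOn F (Ioi 0)) (hFω : F ω = ω) :
    F r / (r + F r) ^ 2 ≤ 2 * (ω / (r ^ 2 + ω ^ 2)) := by
  rw [← mul_div_assoc, div_le_div_iff₀ (by positivity) (by positivity)]
  rcases le_total r ω with h | h
  · have h1 : ω ≤ F r := hFω ▸ hanti hr hω h
    have h2 : r ^ 2 ≤ ω ^ 2 := by gcongr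
    have h3 : ω ^ 2 ≤ F r * ω := by nlinarith
    have : F r * (r ^ 2 + ω ^ 2) ≤ F r * (2 * (F r * ω)) := by gcongr; linarith
    nlinarith [mul_pos hω hr, mul_nonneg (mul_pos hω hr).le hF, mul_pos (mul_pos hω hr) hr]
  · have h1 : F r ≤ ω := hFω ▸ hanti hω hr h
    have h2 : ω ^ 2 ≤ r ^ 2 := by gcongr
    have : F r * (r ^ 2 + ω ^ 2) ≤ ω * (2 * r ^ 2) := by gcongr; linarith
    nlinarith [mul_nonneg (mul_pos hω hr).le hF, mul_nonneg hω.le (mul_nonneg hF hF)]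

theorem IsScalarSolution.exists_norm_laplace_mul_deriv_le {b b' : ℝ → ℝ} {ρ : ℝ}
    (hb : Assumption1 b b' ρ) :
    ∃ C > 0, ∀ lam > 0, ∃ ω > 0, ∀ s s', IsScalarSolution b lam s s' → ∀ z : ℂ, 0 < z.re →
      ‖∫ t in Ioi (0 : ℝ), s' t • (t * Complex.exp (-z * t))‖ ≤ C * (ω / (‖z‖ ^ 2 + ω ^ 2)) := by
  obtain ⟨K, hK, hKle⟩ := hb.exists_norm_add_le
  refine ⟨32 * K ^ 2, by positivity, fun lam hlam => ?_⟩
  obtain ⟨ω, hω, hFω⟩ := hb.exists_primitive_eq hlam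
  refine ⟨ω, hω, fun s s' hs z hz => ?_⟩
  have hzn : 0 < ‖z‖ := norm_pos_iff.2 (by rintro rfl; simp at hz)
  have h1 := congrArg norm (hs.laplace_mul_deriv hb hlam hz).2
  have h2 := hb.norm_laplace_add_le hz
  have h3 := hKle lam hlam z hz
  have hP := hb.primitive_nonneg (inv_pos.2 hzn).le
  have h4 := div_add_sq_le (F := fun r => lam * ∫ u in (0 : ℝ)..r⁻¹, b u) hzn hω
    (by positivity) (fun x hx y hy hxy => by
      have := hb.primitive_mono (inv_pos.2 hy).le (inv_anti₀ hx hxy)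
      dsimp only
      gcongr) hFω
  rw [norm_mul, norm_mul, norm_pow, norm_neg, Complex.norm_real, Real.norm_of_nonneg hlam.le] at h1
  set P := ∫ u in (0 : ℝ)..‖z‖⁻¹, b u
  set N := ‖z + lam * laplaceTransform b z‖
  set W := ‖∫ t in Ioi (0 : ℝ), s' t • (t * Complex.exp (-z * t))‖
  have h5 : (‖z‖ + lam * P) ^ 2 ≤ K ^ 2 * N ^ 2 := by
    rw [← mul_pow]; gcongr
  have h6 : W * N ^ 2 ≤ lam * (16 * P) := by rw [h1]; gcongr
  have h7 : W * (‖z‖ + lam * P) ^ 2 ≤ 16 * K ^ 2 * (lam * P) := by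
    calc W * (‖z‖ + lam * P) ^ 2 ≤ W * (K ^ 2 * N ^ 2) := by gcongr
      _ = K ^ 2 * (W * N ^ 2) := by ring
      _ ≤ K ^ 2 * (lam * (16 * P)) := by gcongr
      _ = _ := by ring
  have h8 : W ≤ 16 * K ^ 2 * (lam * P / (‖z‖ + lam * P) ^ 2) := by
    rw [← mul_div_assoc, le_div_iff₀ (by positivity)]; exact h7
  calc W ≤ _ := h8
    _ ≤ 16 * K ^ 2 * (2 * (ω / (‖z‖ ^ 2 + ω ^ 2))) := by gcongr
    _ = _ := by ring

open scoped FourierTransform in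
/-- Fourier inversion with a Poisson-kernel bound on the transform. -/
theorem norm_le_of_norm_fourier_le {f : ℝ → ℂ} {C ω t : ℝ} (hf : Integrable f)
    (hω : 0 < ω) (ht : ContinuousAt f t)
    (h : ∀ ξ, ‖𝓕 f ξ‖ ≤ C * (ω / (ξ ^ 2 + ω ^ 2))) : ‖f t‖ ≤ C * Real.pi := by
  have he : ∀ ξ : ℝ, C * (ω / (ξ ^ 2 + ω ^ 2)) = C * ω⁻¹ * (1 + (ω⁻¹ * ξ) ^ 2)⁻¹ := by
    intro ξ
    field_simp
    ring
  have hi : Integrable fun ξ : ℝ => C * (ω / (ξ ^ 2 + ω ^ 2)) := by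
    simp only [he]
    exact (integrable_inv_one_add_sq.comp_mul_left' (inv_ne_zero hω.ne')).const_mul _
  have hF : Integrable (𝓕 f) := hi.mono' (VectorFourier.fourierIntegral_continuous Real.continuous_fourierChar
      (innerSL ℝ).continuous₂ hf).aestronglyMeasurable
    (Eventually.of_forall h)
  rw [← hf.fourierInv_fourier_eq hF ht, Real.fourierInv_eq']
  refine (norm_integral_le_integral_norm _).trans ?_
  calc _ = ∫ ξ, ‖𝓕 f ξ‖ := by simp [Complex.norm_exp]
    _ ≤ ∫ ξ, C * (ω / (ξ ^ 2 + ω ^ 2)) := integral_mono hF.norm hi h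
    _ = C * Real.pi := by
      simp only [he]
      rw [integral_const_mul, Measure.integral_comp_mul_left (fun x : ℝ => (1 + x ^ 2)⁻¹),
        integral_univ_inv_one_add_sq, inv_inv, abs_of_pos hω, smul_eq_mul]
      field_simp

open scoped FourierTransform in
/-- Uniform bound on `t s'(t)`. -/
theorem IsScalarSolution.exists_abs_mul_deriv_le {b b' : ℝ → ℝ} {ρ : ℝ}
    (hb : Assumption1 b b' ρ) :
    ∃ M > 0, ∀ lam > 0, ∀ s s', IsScalarSolution b lam s s' → ∀ t > 0, t * |s' t| ≤ M := by
  obtain ⟨C, hC, h⟩ := exists_norm_laplace_mul_deriv_le hb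
  refine ⟨C * Real.pi * Real.exp 1, by positivity, fun lam hlam s s' hs t ht => ?_⟩
  obtain ⟨ω, hω, h⟩ := h lam hlam
  set η := t⁻¹ with hη
  have hη0 : 0 < η := inv_pos.2 ht
  set g : ℝ → ℂ := fun x => s' x • (x * Complex.exp (-(η : ℂ) * x)) with hg
  have hc : ContinuousAt ((Ioi 0).indicator g) t := by
    have h1 : ContinuousAt g t := (hs.continuousAt_deriv hb hlam ht).smul (by fun_prop)
    exact h1.congr (eventually_of_mem (Ioi_mem_nhds ht) fun x hx => (indicator_of_mem hx g).symm)
  have hi : Integrable ((Ioi 0).indicator g) := (integrable_indicator_iff measurableSet_Ioi).2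
    (hs.laplace_mul_deriv hb hlam (z := η) (by simpa using hη0)).1
  have hmain := norm_le_of_norm_fourier_le (C := C) hi hω hc fun ξ => by
    have hz : 0 < ((η : ℂ) + 2 * Real.pi * ξ * Complex.I).re := by simpa using hη0
    have hF : 𝓕 ((Ioi 0).indicator g) ξ = ∫ x in Ioi (0 : ℝ),
        s' x • (x * Complex.exp (-((η : ℂ) + 2 * Real.pi * ξ * Complex.I) * x)) := by
      rw [Real.fourier_real_eq_integral_exp_smul, ← integral_indicator measurableSet_Ioi]
      congr 1 with x
      by_cases hx : x ∈ Ioi 0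
      · have : Complex.exp (-((η : ℂ) + 2 * Real.pi * ξ * Complex.I) * x) =
            Complex.exp (↑(-2 * Real.pi * x * ξ) * Complex.I) * Complex.exp (-(η : ℂ) * x) := by
          rw [← Complex.exp_add]; push_cast; ring_nf
        rw [indicator_of_mem hx, indicator_of_mem hx, this, hg]
        simp only [Complex.real_smul, smul_eq_mul]
        ring
      · rw [indicator_of_notMem hx, indicator_of_notMem hx, smul_zero]
    rw [hF]
    refine (h s s' hs _ hz).trans ?_
    have hξ : ξ ^ 2 ≤ ‖(η : ℂ) + 2 * Real.pi * ξ * Complex.I‖ ^ 2 := by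
      rw [← Complex.normSq_eq_norm_sq, Complex.normSq_apply]
      simp
      nlinarith [Real.pi_gt_three, sq_nonneg ξ, sq_nonneg η, mul_nonneg (sq_nonneg ξ)
        (mul_nonneg (sub_nonneg.2 Real.pi_gt_three.le) (sub_nonneg.2 Real.pi_gt_three.le)),
        mul_nonneg (sq_nonneg ξ) (sub_nonneg.2 Real.pi_gt_three.le)]
    gcongr
  rw [indicator_of_mem (mem_Ioi.2 ht), hg, norm_smul, norm_mul, Complex.norm_real,
    Real.norm_of_nonneg ht.le, Real.norm_eq_abs] at hmain
  have he : ‖Complex.exp (-(η : ℂ) * t)‖ = (Real.exp 1)⁻¹ := by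
    rw [norm_exp_neg_mul_ofReal, Complex.ofReal_re, hη, neg_mul, inv_mul_cancel₀ ht.ne',
      Real.exp_neg]
  rw [he] at hmain
  have := mul_le_mul_of_nonneg_right hmain (Real.exp_pos 1).le
  calc t * |s' t| = |s' t| * (t * (Real.exp 1)⁻¹) * Real.exp 1 := by
        field_simp
    _ ≤ _ := this

theorem rpow_neg_mul_sq_le {lam a B M t σ : ℝ} (hlam : 0 < lam) (hB : 0 ≤ B) (hM : 1 ≤ M)
    (ht : 0 < t) (hσ : σ ∈ Icc (0 : ℝ) 2) (h1 : |a| ≤ lam * B) (h2 : t * |a| ≤ M) :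
    lam ^ (-σ) * a ^ 2 ≤ M ^ 2 * B ^ σ * t ^ (σ - 2) := by
  rcases eq_or_ne a 0 with rfl | ha
  · have : 0 ≤ M ^ 2 * B ^ σ * t ^ (σ - 2) := by positivity
    simpa using this
  have ha : 0 < |a| := abs_pos.2 ha
  have hM0 : 0 < M := by linarith
  have h3 : |a| ≤ M / t := by rw [le_div_iff₀ ht, mul_comm]; exact h2
  have e1 : a ^ 2 = |a| ^ σ * |a| ^ (2 - σ) := by
    rw [← Real.rpow_add ha, add_sub_cancel, Real.rpow_two, sq_abs]
  have e2 : |a| ^ σ ≤ lam ^ σ * B ^ σ := by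
    rw [← Real.mul_rpow hlam.le hB]
    exact Real.rpow_le_rpow ha.le h1 hσ.1
  have e3 : |a| ^ (2 - σ) ≤ M ^ 2 * t ^ (σ - 2) := by
    calc |a| ^ (2 - σ) ≤ (M / t) ^ (2 - σ) := Real.rpow_le_rpow ha.le h3 (by linarith [hσ.2])
      _ = M ^ (2 - σ) * t ^ (σ - 2) := by
        rw [Real.div_rpow hM0.le ht.le, div_eq_mul_inv, ← Real.rpow_neg ht.le, neg_sub]
      _ ≤ M ^ (2 : ℝ) * t ^ (σ - 2) := by
        gcongr
        linarith [hσ.1]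
      _ = _ := by rw [Real.rpow_two]
  calc lam ^ (-σ) * a ^ 2 ≤ lam ^ (-σ) * ((lam ^ σ * B ^ σ) * (M ^ 2 * t ^ (σ - 2))) := by
        rw [e1]; gcongr
    _ = (lam ^ (-σ) * lam ^ σ) * (M ^ 2 * B ^ σ * t ^ (σ - 2)) := by ring
    _ = _ := by rw [← Real.rpow_add hlam, neg_add_cancel, Real.rpow_zero, one_mul]

/-- smoothing estimate `‖A^{-s'/2} Ṡ(t)‖ ≤ C₁ ‖b‖_{L¹(0,t)}^{s'/2} t^{s'/2-1}`
for `0 ≤ s' ≤ 2`, in the spectral (Parseval) form. -/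
theorem statement3 {H : Type*} [NormedAddCommGroup H] [InnerProductSpace ℝ H]
    [CompleteSpace H]
    (b b' : ℝ → ℝ) (ρ : ℝ) (hb : Assumption1 b b' ρ)
    (e : HilbertBasis ℕ ℝ H) (lam : ℕ → ℝ)
    (hlam_pos : ∀ k, 0 < lam k) (hlam_mono : Monotone lam)
    (hlam_top : Tendsto lam atTop atTop)
    (s s' : ℕ → ℝ → ℝ) (hs : ∀ k, IsScalarSolution b (lam k) (s k) (s' k)) :
    ∃ C₁ > 0, ∀ σ ∈ Set.Icc (0 : ℝ) 2, ∀ t > 0, ∀ x : H,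
      (∑' k, ENNReal.ofReal (lam k ^ (-σ) * (s' k t) ^ 2 * ⟪x, e k⟫ ^ 2)) ≤
        ENNReal.ofReal (C₁ ^ 2 * (∫ u in (0 : ℝ)..t, |b u|) ^ σ * t ^ (σ - 2) * ‖x‖ ^ 2) := by
  obtain ⟨M, hM, h⟩ := IsScalarSolution.exists_abs_mul_deriv_le hb
  refine ⟨max 1 M, lt_max_of_lt_left one_pos, fun σ hσ t ht x => ?_⟩
  have hB : ∫ u in (0 : ℝ)..t, |b u| = ∫ u in (0 : ℝ)..t, b u := by
    rw [intervalIntegral.integral_of_le ht.le, intervalIntegral.integral_of_le ht.le]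
    exact setIntegral_congr_fun measurableSet_Ioc fun u hu => abs_of_nonneg (hb.nonneg u hu.1)
  rw [hB]
  have hB0 := hb.primitive_nonneg ht.le
  set c := max 1 M ^ 2 * (∫ u in (0 : ℝ)..t, b u) ^ σ * t ^ (σ - 2)
  have hc0 : 0 ≤ c := by positivity
  have hP : HasSum (fun k => c * ⟪x, e k⟫ ^ 2) (c * ‖x‖ ^ 2) := by
    have := (e.hasSum_inner_mul_inner x x).mul_left c
    rw [real_inner_self_eq_norm_sq] at this
    refine this.congr_fun fun k => ?_
    rw [real_inner_comm x (e k), sq]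
  rw [← hP.tsum_eq, ENNReal.ofReal_tsum_of_nonneg (fun k => by positivity) hP.summable]
  refine ENNReal.tsum_le_tsum fun k => ENNReal.ofReal_le_ofReal ?_
  refine mul_le_mul_of_nonneg_right ?_ (sq_nonneg _)
  exact rpow_neg_mul_sq_le (hlam_pos k) hB0 (le_max_left _ _) ht hσ
    ((hs k).abs_deriv_le hb (hlam_pos k) ht)
    ((h (lam k) (hlam_pos k) (s k) (s' k) (hs k) t ht).trans (le_max_right _ _))
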